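/- arXiv:1906.10246 — 7 statements merged into one kernel-verified Lean document; each statement's English description precedes it below -/
import Mathlib

section
/- Let a < b and μ be real numbers. Then as the real parameter t tends to +∞, (1/π) ∫_{(μ−b)t}^{(μ−a)t} (sin y)/y dy converges to 1 if a < μ < b, converges to 1/2 if μ = a or μ = b, and converges to 0 if μ < a or μ > b. -/
open MeasureTheory Real Filter

/-- The real part of `∫ exp (i T e^{iθ}) dθ` over the quarter circle, as a function of `T`,
is a primitive of `-sinc`. -/
lemma hasDerivAt_integral_exp_mul_cos (T : ℝ) :
    HasDerivAt (fun T : ℝ => ∫ θ in (0 : ℝ)..(π / 2), exp (-(T * sin θ)) * cos (T * cos θ))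
      (-sinc T) T := by
  let F' : ℝ → ℝ → ℝ := fun T θ =>
    exp (-(T * sin θ)) * (-sin θ * cos (T * cos θ) - cos θ * sin (T * cos θ))
  have hderiv : HasDerivAt
      (fun T : ℝ => ∫ θ in (0 : ℝ)..(π / 2), exp (-(T * sin θ)) * cos (T * cos θ))
      (∫ θ in (0 : ℝ)..(π / 2), F' T θ) T := by
    refine (intervalIntegral.hasDerivAt_integral_of_dominated_loc_of_deriv_le
      (F := fun T θ => exp (-(T * sin θ)) * cos (T * cos θ)) (F' := F')
      (bound := fun _ => exp (|T| + 1) * 2) (Metric.ball_mem_nhds T one_pos)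
      (Eventually.of_forall fun x => ?_) ?_ ?_ ?_ intervalIntegrable_const ?_).2
    · exact Continuous.aestronglyMeasurable (by fun_prop)
    · exact Continuous.intervalIntegrable (by fun_prop) _ _
    · exact Continuous.aestronglyMeasurable (by fun_prop)
    · refine Eventually.of_forall fun θ _ x hx => ?_
      have hxT : |x| ≤ |T| + 1 := by
        have h₁ := abs_sub_abs_le_abs_sub x T
        rw [Metric.mem_ball, Real.dist_eq] at hx
        linarith
      have hprod (u v : ℝ) (hu : |u| ≤ 1) (hv : |v| ≤ 1) : |u * v| ≤ 1 := by
        rw [abs_mul]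
        exact mul_le_one₀ hu (abs_nonneg v) hv
      rw [Real.norm_eq_abs, abs_mul, abs_exp]
      gcongr
      · calc -(x * sin θ) ≤ |x * sin θ| := neg_le_abs _
          _ = |x| * |sin θ| := abs_mul _ _
          _ ≤ |x| * 1 := by gcongr; exact abs_sin_le_one θ
          _ ≤ |T| + 1 := by linarith
      · have h₁ := abs_le.mp (hprod _ _ (abs_sin_le_one θ) (abs_cos_le_one (x * cos θ)))
        have h₂ := abs_le.mp (hprod _ _ (abs_cos_le_one θ) (abs_sin_le_one (x * cos θ)))
        rw [abs_le]
        constructor <;> linarith [h₁.1, h₁.2, h₂.1, h₂.2]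
    · refine Eventually.of_forall fun θ _ x _ => ?_
      have he := ((hasDerivAt_mul_const (x := x) (sin θ)).neg).exp
      have hc := (hasDerivAt_mul_const (x := x) (cos θ)).cos
      refine (he.mul hc).congr_deriv ?_
      simp only [F', Pi.neg_apply]
      ring
  convert hderiv using 1
  rcases eq_or_ne T 0 with rfl | hT
  · simp [F']
  · have hprim (θ : ℝ) :
        HasDerivAt (fun θ => exp (-(T * sin θ)) * sin (T * cos θ)) (T * F' T θ) θ := by
      have he := (((hasDerivAt_sin θ).const_mul T).neg).exp
      have hs := ((hasDerivAt_cos θ).const_mul T).sin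
      refine (he.mul hs).congr_deriv ?_
      simp only [F', Pi.neg_apply]
      ring
    have hint := intervalIntegral.integral_eq_sub_of_hasDerivAt (a := 0) (b := π / 2)
      (fun θ _ => hprim θ) (Continuous.intervalIntegrable (by fun_prop) _ _)
    rw [intervalIntegral.integral_const_mul] at hint
    simp only [sin_pi_div_two, cos_pi_div_two, sin_zero, cos_zero, mul_zero, mul_one, neg_zero,
      exp_zero, one_mul, zero_sub] at hint
    rw [sinc_of_ne_zero hT]
    field_simp
    linarith

lemma integral_sinc_eq_sub (T : ℝ) :
    ∫ y in (0 : ℝ)..T, sinc y =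
      π / 2 - ∫ θ in (0 : ℝ)..(π / 2), exp (-(T * sin θ)) * cos (T * cos θ) := by
  have h := intervalIntegral.integral_eq_sub_of_hasDerivAt (a := 0) (b := T)
    (fun x _ => hasDerivAt_integral_exp_mul_cos x)
    (continuous_sinc.neg.intervalIntegrable _ _)
  rw [intervalIntegral.integral_neg] at h
  simp only [zero_mul, neg_zero, exp_zero, cos_zero, mul_one, intervalIntegral.integral_const,
    sub_zero, smul_eq_mul] at h
  linarith

/-- The Dirichlet integral. -/
lemma tendsto_integral_sinc_atTop :
    Tendsto (fun T : ℝ => ∫ y in (0 : ℝ)..T, sinc y) atTop (nhds (π / 2)) := by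
  have hzero : Tendsto
      (fun T : ℝ => ∫ θ in (0 : ℝ)..(π / 2), exp (-(T * sin θ)) * cos (T * cos θ))
      atTop (nhds (∫ _ in (0 : ℝ)..(π / 2), (0 : ℝ))) := by
    have hsin {θ : ℝ} (hθ : θ ∈ Set.uIoc 0 (π / 2)) : 0 < sin θ := by
      rw [Set.uIoc_of_le (by positivity)] at hθ
      exact sin_pos_of_pos_of_lt_pi hθ.1 (by linarith [hθ.2, pi_pos])
    have hle (T θ : ℝ) : ‖exp (-(T * sin θ)) * cos (T * cos θ)‖ ≤ exp (-(T * sin θ)) := by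
      rw [Real.norm_eq_abs, abs_mul, abs_exp]
      exact mul_le_of_le_one_right (exp_pos _).le (abs_cos_le_one _)
    refine intervalIntegral.tendsto_integral_filter_of_dominated_convergence (fun _ => 1)
      (Eventually.of_forall fun T => Continuous.aestronglyMeasurable (by fun_prop)) ?_
      intervalIntegrable_const ?_
    · filter_upwards [eventually_ge_atTop 0] with T hT
      refine Eventually.of_forall fun θ hθ => (hle T θ).trans ?_
      rw [exp_le_one_iff, neg_nonpos]
      exact mul_nonneg hT (hsin hθ).le
    · refine Eventually.of_forall fun θ hθ => squeeze_zero_norm (hle · θ) ?_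
      exact tendsto_exp_neg_atTop_nhds_zero.comp (tendsto_id.atTop_mul_const (hsin hθ))
  simpa [integral_sinc_eq_sub] using hzero.const_sub (π / 2)

lemma tendsto_integral_sinc_atBot :
    Tendsto (fun T : ℝ => ∫ y in (0 : ℝ)..T, sinc y) atBot (nhds (-(π / 2))) := by
  refine (tendsto_integral_sinc_atTop.comp tendsto_neg_atBot_atTop).neg.congr fun T => ?_
  have h := intervalIntegral.integral_comp_neg (a := 0) (b := T) sinc
  simp only [sinc_neg, neg_zero] at h
  rw [h, Function.comp_apply, intervalIntegral.integral_symm, neg_neg]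

lemma tendsto_integral_sinc_mul_of_pos {c : ℝ} (hc : 0 < c) :
    Tendsto (fun t : ℝ => ∫ y in (0 : ℝ)..(c * t), sinc y) atTop (nhds (π / 2)) :=
  tendsto_integral_sinc_atTop.comp (tendsto_id.const_mul_atTop hc)

lemma tendsto_integral_sinc_mul_of_neg {c : ℝ} (hc : c < 0) :
    Tendsto (fun t : ℝ => ∫ y in (0 : ℝ)..(c * t), sinc y) atTop (nhds (-(π / 2))) :=
  tendsto_integral_sinc_atBot.comp (tendsto_id.const_mul_atTop_of_neg hc)

lemma tendsto_inv_pi_mul_integral_sinc {p q l m L : ℝ}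
    (hp : Tendsto (fun t : ℝ => ∫ y in (0 : ℝ)..(p * t), sinc y) atTop (nhds l))
    (hq : Tendsto (fun t : ℝ => ∫ y in (0 : ℝ)..(q * t), sinc y) atTop (nhds m))
    (hL : m - l = π * L) :
    Tendsto (fun t : ℝ => (1/π) * ∫ y in (p * t)..(q * t),
      if y = 0 then (1:ℝ) else Real.sin y / y) atTop (nhds L) := by
  have h := (hq.sub hp).const_mul (1 / π)
  rw [hL, ← mul_assoc, one_div_mul_cancel pi_ne_zero, one_mul] at h
  refine h.congr fun t => ?_
  rw [intervalIntegral.integral_interval_sub_left (continuous_sinc.intervalIntegrable _ _)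
    (continuous_sinc.intervalIntegrable _ _)]
  rfl

/-- For reals `a < b` and `μ`, as `t → +∞`,
`(1/π) ∫_{(μ−b)t}^{(μ−a)t} (sin y)/y dy` converges to `1` if `a < μ < b`, to `1/2` if
`μ = a` or `μ = b`, and to `0` if `μ < a` or `μ > b`; the integrand `(sin y)/y` is
extended by the value `1` at `y = 0`. -/
theorem dirichlet_integral_limit_bounded (a b μ : ℝ) (hab : a < b) :
    (a < μ → μ < b →
      Tendsto (fun t : ℝ => (1/π) * ∫ y in ((μ - b) * t)..((μ - a) * t),
          if y = 0 then (1:ℝ) else Real.sin y / y) atTop (nhds 1)) ∧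
    (μ = a ∨ μ = b →
      Tendsto (fun t : ℝ => (1/π) * ∫ y in ((μ - b) * t)..((μ - a) * t),
          if y = 0 then (1:ℝ) else Real.sin y / y) atTop (nhds (1/2))) ∧
    (μ < a ∨ b < μ →
      Tendsto (fun t : ℝ => (1/π) * ∫ y in ((μ - b) * t)..((μ - a) * t),
          if y = 0 then (1:ℝ) else Real.sin y / y) atTop (nhds 0)) := by
  refine ⟨fun ha hb => ?_, ?_, ?_⟩
  · exact tendsto_inv_pi_mul_integral_sinc (tendsto_integral_sinc_mul_of_neg (sub_neg.2 hb))
      (tendsto_integral_sinc_mul_of_pos (sub_pos.2 ha)) (by ring)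
  · rintro (rfl | rfl)
    · refine tendsto_inv_pi_mul_integral_sinc (tendsto_integral_sinc_mul_of_neg (sub_neg.2 hab))
        (m := 0) ?_ (by ring)
      simp
    · refine tendsto_inv_pi_mul_integral_sinc (l := 0) ?_
        (tendsto_integral_sinc_mul_of_pos (sub_pos.2 hab)) (by ring)
      simp
  · rintro (h | h)
    · exact tendsto_inv_pi_mul_integral_sinc
        (tendsto_integral_sinc_mul_of_neg (sub_neg.2 (h.trans hab)))
        (tendsto_integral_sinc_mul_of_neg (sub_neg.2 h)) (by ring)
    · exact tendsto_inv_pi_mul_integral_sinc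
        (tendsto_integral_sinc_mul_of_pos (sub_pos.2 h))
        (tendsto_integral_sinc_mul_of_pos (sub_pos.2 (hab.trans h))) (by ring)
end

section
/- For μ′ ∈ ℝ define K_{1,0}(t,x;μ′) = ∫_{[−1,1]} ω(s) cos{t s (x−μ′)}/r₀(t s) ds. Then for every μ ∈ ℝ and every t ∈ ℝ, ∫ K_{1,0}(t,x;μ′) dF_μ(x) = ∫_{[−1,1]} ω(s) cos{t s (μ−μ′)} ds; in particular ∫ K_{1,0}(t,x;μ′) dF_{μ′}(x) = 1 for all t ∈ ℝ. -/
open MeasureTheory Real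

/-- The characteristic function of a probability measure is continuous, hence so is any real function
representing it. -/
lemma continuous_of_integral_exp_eq_ofReal (ν : Measure ℝ) [IsProbabilityMeasure ν] (r : ℝ → ℝ)
    (hr : ∀ t : ℝ, (∫ x, Complex.exp (Complex.I * (t : ℂ) * (x : ℂ)) ∂ν) = ((r t : ℝ) : ℂ)) :
    Continuous r := by
  have h : r = fun t => (charFun ν t).re := by
    funext t
    have h1 : charFun ν t = (r t : ℂ) := by
      rw [← hr t, charFun_apply_real]
      refine integral_congr_ae (.of_forall fun x => ?_)
      ring_nf
    rw [h1, Complex.ofReal_re]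
  rw [h]
  exact Complex.continuous_re.comp continuous_charFun

/-- If the characteristic function of `ν` is real, then translating the argument of a cosine only
multiplies its mean by the cosine of the translation. -/
lemma integral_cos_mul_add_of_integral_exp_eq_ofReal (ν : Measure ℝ) [IsProbabilityMeasure ν]
    {u r : ℝ} (hr : (∫ x, Complex.exp (Complex.I * (u : ℂ) * (x : ℂ)) ∂ν) = (r : ℂ)) (c : ℝ) :
    ∫ x, Real.cos (u * (x + c)) ∂ν = Real.cos (u * c) * r := by
  have hint : Integrable (fun x : ℝ => Complex.exp ((u * (x + c) : ℝ) * Complex.I)) ν := by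
    refine Integrable.of_bound (by fun_prop) 1 (.of_forall fun x => ?_)
    rw [Complex.norm_exp_ofReal_mul_I]
  have h : ∫ x : ℝ, Complex.exp ((u * (x + c) : ℝ) * Complex.I) ∂ν
      = Complex.exp ((u * c : ℝ) * Complex.I) * (r : ℂ) := by
    rw [← hr, ← integral_const_mul]
    refine integral_congr_ae (.of_forall fun x => ?_)
    simp only [← Complex.exp_add]
    push_cast
    ring_nf
  have h2 := congrArg Complex.re h
  rw [Complex.re_mul_ofReal, Complex.exp_ofReal_mul_I_re] at h2
  rw [← h2, ← RCLike.re_eq_complex_re, ← integral_re hint]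
  simp only [RCLike.re_eq_complex_re, Complex.exp_ofReal_mul_I_re]

/-- For a Type I location-shift family `{F_μ}` generated by a probability
measure `ν` with real, strictly positive characteristic function `r₀`, and an even,
bounded probability density `ω` on `[−1,1]`, the kernel
`K_{1,0}(t,x;μ′) = ∫_{[−1,1]} ω(s) cos{ts(x−μ′)}/r₀(ts) ds` satisfies
`∫ K_{1,0}(t,x;μ′) dF_μ(x) = ∫_{[−1,1]} ω(s) cos{ts(μ−μ′)} ds` for all `μ, t`; in
particular `∫ K_{1,0}(t,x;μ′) dF_{μ′}(x) = 1` for all `t`. -/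
theorem matching_kernel_point_null_locationShift
    (ν : Measure ℝ) [IsProbabilityMeasure ν]
    (r₀ : ℝ → ℝ)
    (hr₀_pos : ∀ t : ℝ, 0 < r₀ t)
    (hr₀_cf : ∀ t : ℝ, (∫ x, Complex.exp (Complex.I * (t : ℂ) * (x : ℂ)) ∂ν) = ((r₀ t : ℝ) : ℂ))
    (F : ℝ → Measure ℝ)
    (hF : ∀ μ : ℝ, F μ = Measure.map (fun x => x + μ) ν)
    (ω : ℝ → ℝ)
    (hω_meas : Measurable ω)
    (hω_nonneg : ∀ s, 0 ≤ ω s)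
    (hω_even : ∀ s, ω (-s) = ω s)
    (hω_supp : ∀ s, s ∉ Set.Icc (-1:ℝ) 1 → ω s = 0)
    (hω_bdd : ∃ M : ℝ, ∀ s, ω s ≤ M)
    (hω_prob : ∫ s, ω s = 1)
    (K₁₀ : ℝ → ℝ → ℝ → ℝ)
    (hK₁₀ : ∀ t x μ', K₁₀ t x μ'
      = ∫ s in (-1:ℝ)..(1:ℝ), ω s * Real.cos (t * s * (x - μ')) / r₀ (t * s))
    (μ' : ℝ) :
    (∀ μ t : ℝ, (∫ x, K₁₀ t x μ' ∂(F μ))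
        = ∫ s in (-1:ℝ)..(1:ℝ), ω s * Real.cos (t * s * (μ - μ'))) ∧
    (∀ t : ℝ, (∫ x, K₁₀ t x μ' ∂(F μ')) = 1) := by
  have hr_cont : Continuous r₀ := continuous_of_integral_exp_eq_ofReal ν r₀ hr₀_cf
  have hω_int : Integrable ω := by
    by_contra h
    rw [integral_undef h] at hω_prob
    exact zero_ne_one hω_prob
  have key : ∀ μ t : ℝ, (∫ x, K₁₀ t x μ' ∂(F μ))
      = ∫ s in (-1:ℝ)..(1:ℝ), ω s * Real.cos (t * s * (μ - μ')) := by
    intro μ t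
    have hg : IntegrableOn (fun s => ω s * (r₀ (t * s))⁻¹) (Set.Ioc (-1) 1) := by
      have hinv : Continuous fun s => (r₀ (t * s))⁻¹ :=
        (hr_cont.comp (continuous_const.mul continuous_id)).inv₀ fun s => (hr₀_pos _).ne'
      exact (hω_int.integrableOn.mul_continuousOn hinv.continuousOn isCompact_Icc).mono_set
        Set.Ioc_subset_Icc_self
    have hprod : Integrable
        (Function.uncurry fun x s : ℝ => ω s * Real.cos (t * s * (x + μ - μ')) / r₀ (t * s))
        (ν.prod (volume.restrict (Set.Ioc (-1) 1))) := by
      have hcos : Continuous fun z : ℝ × ℝ => Real.cos (t * z.2 * (z.1 + μ - μ')) := by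
        fun_prop
      refine ((hg.comp_snd ν).mul_bdd (c := 1) hcos.aestronglyMeasurable
        (.of_forall fun z => Real.abs_cos_le_one _)).congr (.of_forall fun z => ?_)
      simp only [Function.uncurry]
      ring
    rw [hF, (measurableEmbedding_addRight μ).integral_map]
    simp only [hK₁₀,
      intervalIntegral.integral_of_le (show (-1 : ℝ) ≤ 1 by norm_num)]
    rw [integral_integral_swap hprod]
    refine integral_congr_ae (.of_forall fun s => ?_)
    simp only [add_sub_assoc]
    rw [integral_div, integral_const_mul,
      integral_cos_mul_add_of_integral_exp_eq_ofReal ν (hr₀_cf (t * s)), ← mul_assoc,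
      mul_div_cancel_right₀ _ (hr₀_pos _).ne']
  refine ⟨key, fun t => ?_⟩
  rw [key]
  simp only [sub_self, mul_zero, Real.cos_zero, mul_one]
  rw [intervalIntegral.integral_of_le (by norm_num), ← integral_Icc_eq_integral_Ioc,
    setIntegral_eq_integral_of_forall_compl_eq_zero hω_supp, hω_prob]
end

section
/- Let a < b be reals and define K₁(t,x) = (t/(2π)) ∫_a^b ( ∫_{[−1,1]} cos{t s (x−y)}/r₀(t s) ds ) dy. Then for every μ ∈ ℝ and every t ∈ ℝ, ∫ K₁(t,x) dF_μ(x) = (1/π) ∫_{(μ−b)t}^{(μ−a)t} (sin y)/y dy, where the integrand (sin y)/y is extended by the value 1 at y = 0. -/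
open MeasureTheory Real

theorem integral_intervalIntegral_swap_of_continuous_of_bounded
    (ν : Measure ℝ) [IsFiniteMeasure ν] {f : ℝ → ℝ → ℝ} (hf : Continuous (Function.uncurry f))
    {a b C : ℝ} (hab : a ≤ b) (hC : ∀ x, ∀ y ∈ Set.Icc a b, ‖f x y‖ ≤ C) :
    ∫ x, (∫ y in a..b, f x y) ∂ν = ∫ y in a..b, ∫ x, f x y ∂ν := by
  simp only [intervalIntegral.integral_of_le hab]
  refine integral_integral_swap (Integrable.of_bound hf.aestronglyMeasurable C ?_)
  have h : ∀ᵐ p ∂(ν.prod (volume.restrict (Set.Ioc a b))), p.2 ∈ Set.Ioc a b :=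
    Measure.quasiMeasurePreserving_snd.ae (ae_restrict_mem measurableSet_Ioc)
  filter_upwards [h] with p hp
  exact hC p.1 p.2 (Set.Ioc_subset_Icc_self hp)

theorem integral_cos_mul_add_of_charFun_eq_ofReal
    (ν : Measure ℝ) [IsFiniteMeasure ν] {c r : ℝ} (h : charFun ν c = (r : ℂ)) (d : ℝ) :
    ∫ x, Real.cos (c * x + d) ∂ν = Real.cos d * r := by
  have hint : Integrable (fun x : ℝ => Complex.exp (c * x * Complex.I)) ν := by
    refine Integrable.of_bound (by fun_prop) 1 (Filter.Eventually.of_forall fun x => ?_)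
    rw [← Complex.ofReal_mul, Complex.norm_exp_ofReal_mul_I]
  have hre (x : ℝ) : Real.cos (c * x + d)
      = (Complex.exp (d * Complex.I) * Complex.exp (c * x * Complex.I)).re := by
    rw [← Complex.exp_add, ← add_mul, add_comm]
    exact_mod_cast (Complex.exp_ofReal_mul_I_re _).symm
  simp_rw [hre]
  have key := integral_re (𝕜 := ℂ) (hint.const_mul (Complex.exp (d * Complex.I)))
  simp only [RCLike.re_to_complex] at key
  rw [key, integral_const_mul, ← charFun_apply_real, h, Complex.re_mul_ofReal,
    Complex.exp_ofReal_mul_I_re]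

theorem integral_cos_mul_neg_one_one (c : ℝ) :
    ∫ s in (-1 : ℝ)..1, Real.cos (c * s) = 2 * sinc c := by
  rcases eq_or_ne c 0 with rfl | hc
  · norm_num
  · rw [intervalIntegral.integral_comp_mul_left _ hc, integral_cos, sinc_of_ne_zero hc]
    simp only [mul_one, mul_neg, Real.sin_neg, smul_eq_mul]
    ring

/-- For a Type I location-shift family `{F_μ}` generated by a probability
measure `ν` with real, strictly positive characteristic function `r₀`, and reals `a < b`,
the kernel `K₁(t,x) = (t/(2π)) ∫_a^b (∫_{[−1,1]} cos{ts(x−y)}/r₀(ts) ds) dy` satisfies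
`∫ K₁(t,x) dF_μ(x) = (1/π) ∫_{(μ−b)t}^{(μ−a)t} (sin y)/y dy` for all `μ, t`, where the
integrand `(sin y)/y` is extended by the value `1` at `y = 0`. -/
theorem matching_kernel_bounded_null_locationShift
    (ν : Measure ℝ) [IsProbabilityMeasure ν]
    (r₀ : ℝ → ℝ)
    (hr₀_pos : ∀ t : ℝ, 0 < r₀ t)
    (hr₀_cf : ∀ t : ℝ, (∫ x, Complex.exp (Complex.I * (t : ℂ) * (x : ℂ)) ∂ν) = ((r₀ t : ℝ) : ℂ))
    (F : ℝ → Measure ℝ)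
    (hF : ∀ μ : ℝ, F μ = Measure.map (fun x => x + μ) ν)
    (a b : ℝ) (hab : a < b)
    (K₁ : ℝ → ℝ → ℝ)
    (hK₁ : ∀ t x, K₁ t x
      = (t / (2 * π)) * ∫ y in a..b, ∫ s in (-1:ℝ)..(1:ℝ), Real.cos (t * s * (x - y)) / r₀ (t * s)) :
    ∀ μ t : ℝ, (∫ x, K₁ t x ∂(F μ))
      = (1/π) * ∫ y in ((μ - b) * t)..((μ - a) * t),
          if y = 0 then (1:ℝ) else Real.sin y / y := by
  intro μ t
  have hcf (u : ℝ) : charFun ν u = (r₀ u : ℂ) := by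
    rw [charFun_apply_real, ← hr₀_cf]
    simp only [mul_comm, mul_left_comm]
  have hr₀_cont : Continuous r₀ := by
    have h : r₀ = fun u => (charFun ν u).re := by
      ext u
      rw [hcf, Complex.ofReal_re]
    rw [h]
    exact Complex.continuous_re.comp continuous_charFun
  have hinv : Continuous fun s => (r₀ (t * s))⁻¹ :=
    (hr₀_cont.comp (by fun_prop)).inv₀ fun s => (hr₀_pos _).ne'
  obtain ⟨M, hM⟩ := (isCompact_Icc (a := (-1 : ℝ)) (b := 1)).exists_bound_of_continuousOn
    hinv.continuousOn
  have hbound (x y s : ℝ) (hs : s ∈ Set.Icc (-1 : ℝ) 1) :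
      ‖Real.cos (t * s * (x + μ - y)) / r₀ (t * s)‖ ≤ M := by
    rw [div_eq_mul_inv, norm_mul]
    calc _ ≤ 1 * ‖(r₀ (t * s))⁻¹‖ := by
          gcongr
          exact Real.abs_cos_le_one _
      _ ≤ M := by simpa using hM s hs
  have hmean (y s : ℝ) : ∫ x, Real.cos (t * s * (x + μ - y)) / r₀ (t * s) ∂ν
      = Real.cos (t * (μ - y) * s) := by
    have h (x : ℝ) : t * s * (x + μ - y) = t * s * x + t * (μ - y) * s := by ring
    simp_rw [h]
    rw [integral_div, integral_cos_mul_add_of_charFun_eq_ofReal ν (hcf (t * s)),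
      mul_div_cancel_right₀ _ (hr₀_pos _).ne']
  have hinner (y : ℝ) :
      ∫ x, (∫ s in (-1 : ℝ)..1, Real.cos (t * s * (x + μ - y)) / r₀ (t * s)) ∂ν
        = 2 * sinc (t * μ - t * y) := by
    rw [integral_intervalIntegral_swap_of_continuous_of_bounded ν (C := M) _ (by norm_num)
      fun x s hs => hbound x y s hs]
    · simp_rw [hmean, integral_cos_mul_neg_one_one, mul_sub]
    · simp only [Function.uncurry_def, div_eq_mul_inv]
      exact (by fun_prop : Continuous fun p : ℝ × ℝ => Real.cos (t * p.2 * (p.1 + μ - y))).mul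
        (hinv.comp continuous_snd)
  have hcont : Continuous (Function.uncurry fun x y : ℝ =>
      ∫ s in (-1 : ℝ)..1, Real.cos (t * s * (x + μ - y)) / r₀ (t * s)) := by
    refine intervalIntegral.continuous_parametric_intervalIntegral_of_continuous' ?_ _ _
    simp only [Function.uncurry_def, div_eq_mul_inv]
    exact (by fun_prop : Continuous fun p : (ℝ × ℝ) × ℝ =>
      Real.cos (t * p.2 * (p.1.1 + μ - p.1.2))).mul (hinv.comp continuous_snd)
  have hsinc : (fun y : ℝ => if y = 0 then (1 : ℝ) else Real.sin y / y) = sinc := rfl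
  rw [hF, (measurableEmbedding_addRight μ).integral_map, hsinc]
  simp_rw [hK₁]
  rw [integral_const_mul, integral_intervalIntegral_swap_of_continuous_of_bounded ν hcont
    hab.le (C := M * |1 - (-1)|) fun x y _ =>
      intervalIntegral.norm_integral_le_of_norm_le_const fun s hs =>
        hbound x y s (Set.Ioc_subset_Icc_self (by rwa [Set.uIoc_of_le (by norm_num)] at hs))]
  simp_rw [hinner]
  have hsub := intervalIntegral.mul_integral_comp_sub_mul (a := a) (b := b) (f := sinc) t (t * μ)
  rw [intervalIntegral.integral_const_mul, show (μ - b) * t = t * μ - t * b by ring,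
    show (μ - a) * t = t * μ - t * a by ring, ← hsub]
  field_simp
end

section
/- Assume in addition that ν is absolutely continuous with respect to Lebesgue measure, that ∫ |x| dν(x) < ∞ (so r₀ is differentiable), and that ∫₀ᵗ (1/y) ∫_{−1}^{1} |(d/ds)(1/r₀(y s))| ds dy < ∞ for every t > 0. Define K₁†(t,x) = (1/(2π)) ∫₀¹ ∫_{−1}^{1} (1/(i y)) · (d/ds)[exp(i t y s x)/r₀(t y s)] ds dy. Then for every μ ∈ ℝ with ∫ |x| dF_μ(x) < ∞ and every t ∈ ℝ, ∫ K₁†(t,x) dF_μ(x) = (1/(2π)) ∫₀ᵗ ( ∫_{−1}^{1} μ · exp(i y s μ) ds ) dy. -/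
open MeasureTheory Real

/-- Fubini for a jointly continuous integrand with at most linear growth in the variable that is
integrated against a finite measure with finite first moment. -/
lemma integral_intervalIntegral_comm_of_continuous_of_norm_le {G : Measure ℝ} [IsFiniteMeasure G]
    (hG : Integrable (fun x : ℝ => |x|) G) {g : ℝ → ℝ → ℂ} (hg : Continuous g.uncurry)
    {a b C : ℝ} (hC : ∀ y ∈ Set.uIoc a b, ∀ x, ‖g y x‖ ≤ C * (1 + |x|)) :
    ∫ x, (∫ y in a..b, g y x) ∂G = ∫ y in a..b, ∫ x, g y x ∂G := by
  refine (intervalIntegral_integral_swap ?_).symm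
  have : IsFiniteMeasure (volume.restrict (Set.uIoc a b)) := ⟨by simp [Set.uIoc]⟩
  have hdom : Integrable (fun z : ℝ × ℝ => C * (1 + |z.2|))
      ((volume.restrict (Set.uIoc a b)).prod G) :=
    (((integrable_const (1 : ℝ)).add hG).const_mul C).comp_snd _
  refine hdom.mono' hg.aestronglyMeasurable ?_
  have hmem : ∀ᵐ z ∂((volume.restrict (Set.uIoc a b)).prod G), z.1 ∈ Set.uIoc a b :=
    Measure.quasiMeasurePreserving_fst.ae (ae_restrict_mem measurableSet_uIoc)
  filter_upwards [hmem] with z hz using hC z.1 hz z.2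

/-- A real characteristic function of a measure with finite first moment is `C¹`. -/
lemma contDiff_one_of_charFun_eq_ofReal {ν : Measure ℝ} [IsFiniteMeasure ν]
    (hν : Integrable (fun x : ℝ => |x|) ν) {r : ℝ → ℝ} (hr : ∀ t, charFun ν t = (r t : ℂ)) :
    ContDiff ℝ 1 r := by
  have hmem : MemLp id ((1 : ℕ) : ENNReal) ν := by
    simpa [memLp_one_iff_integrable] using
      (integrable_norm_iff (f := (id : ℝ → ℝ)) aestronglyMeasurable_id).1 hν
  have hre : r = fun t => (charFun ν t).re := by
    funext t
    simp [hr]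
  rw [hre]
  exact Complex.reCLM.contDiff.comp (contDiff_charFun hmem)

/-- The normalised integrand of the kernel integrates to `μ exp(iuμ)` against a law with
characteristic function `exp(iuμ) r(u)`. -/
lemma integral_exp_mul_of_charFun_eq {G : Measure ℝ} [IsFiniteMeasure G]
    (hG : Integrable (fun x : ℝ => |x|) G) {r : ℝ → ℝ} (hr : Differentiable ℝ r) {μ : ℝ}
    (hcf : ∀ t : ℝ, charFun G t = Complex.exp (Complex.I * t * μ) * r t) {u : ℝ}
    (hu : r u ≠ 0) :
    ∫ x, Complex.exp (Complex.I * u * x)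
        * ((x : ℂ) / r u + Complex.I * (deriv r u : ℝ) / (r u : ℂ) ^ 2) ∂G
      = (μ : ℂ) * Complex.exp (Complex.I * u * μ) := by
  have hid : Integrable (id : ℝ → ℝ) G :=
    (integrable_norm_iff (f := (id : ℝ → ℝ)) aestronglyMeasurable_id).1 hG
  have hmem : MemLp id ((1 : ℕ) : ENNReal) G := by
    simpa [memLp_one_iff_integrable] using hid
  have hexp : Integrable (fun x : ℝ => Complex.exp (Complex.I * u * x)) G := by
    refine (integrable_const (1 : ℝ)).mono' (by fun_prop) (.of_forall fun x => ?_)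
    rw [mul_assoc, mul_comm, ← Complex.ofReal_mul, Complex.norm_exp_ofReal_mul_I]
  have hxexp : Integrable (fun x : ℝ => (x : ℂ) * Complex.exp (Complex.I * u * x)) G := by
    refine hG.mono' (by fun_prop) (.of_forall fun x => ?_)
    rw [norm_mul, mul_assoc, mul_comm Complex.I, ← Complex.ofReal_mul,
      Complex.norm_exp_ofReal_mul_I]
    simp
  have hderiv : HasDerivAt (charFun G)
      (Complex.exp (Complex.I * u * μ) * (Complex.I * μ) * r u
        + Complex.exp (Complex.I * u * μ) * (deriv r u : ℝ)) u := by
    rw [funext hcf]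
    have h1 : HasDerivAt (fun t : ℝ => Complex.I * t * μ) (Complex.I * μ) u := by
      simpa using ((Complex.ofRealCLM.hasDerivAt (x := u)).const_mul Complex.I).mul_const (μ : ℂ)
    exact h1.cexp.mul (hr u).hasDerivAt.ofReal_comp
  have hmoment := iteratedDeriv_charFun (t := u) hmem
  rw [iteratedDeriv_one, hderiv.deriv] at hmoment
  have h0 := hcf u
  rw [charFun_apply_real] at h0
  have he : ∀ x : ℝ, Complex.exp (u * x * Complex.I) = Complex.exp (Complex.I * u * x) :=
    fun x => by ring_nf
  simp only [he, pow_one] at h0 hmoment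
  have hsplit : ∀ x : ℝ, Complex.exp (Complex.I * u * x)
        * ((x : ℂ) / r u + Complex.I * (deriv r u : ℝ) / (r u : ℂ) ^ 2)
      = (1 / (r u : ℂ)) * ((x : ℂ) * Complex.exp (Complex.I * u * x))
        + (Complex.I * (deriv r u : ℝ) / (r u : ℂ) ^ 2) * Complex.exp (Complex.I * u * x) :=
    fun x => by ring
  simp only [hsplit]
  rw [integral_add (hxexp.const_mul _) (hexp.const_mul _), integral_const_mul,
    integral_const_mul, h0]
  have hI : ∫ x : ℝ, (x : ℂ) * Complex.exp (Complex.I * u * x) ∂G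
      = -Complex.I * (Complex.exp (Complex.I * u * μ) * (Complex.I * μ) * r u
        + Complex.exp (Complex.I * u * μ) * (deriv r u : ℝ)) := by
    rw [hmoment, ← mul_assoc]
    simp
  rw [hI]
  have hu' : (r u : ℂ) ≠ 0 := by exact_mod_cast hu
  field_simp
  linear_combination (-(μ : ℂ) * r u) * Complex.I_sq

/-- The factor `1 / (iy)` of the kernel integrand cancels against the inner derivative. -/
lemma deriv_exp_div_charFun {r : ℝ → ℝ} (hr : Differentiable ℝ r) (hpos : ∀ t, 0 < r t)
    (t x s : ℝ) {y : ℝ} (hy : y ≠ 0) :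
    (1 / (Complex.I * (y : ℂ))) * deriv (fun s' : ℝ =>
        Complex.exp (Complex.I * (t : ℂ) * (y : ℂ) * (s' : ℂ) * (x : ℂ))
          / ((r (t * y * s') : ℝ) : ℂ)) s
      = t * (Complex.exp (Complex.I * ((t * y * s : ℝ) : ℂ) * x)
        * ((x : ℂ) / r (t * y * s)
          + Complex.I * (deriv r (t * y * s) : ℝ) / (r (t * y * s) : ℂ) ^ 2)) := by
  have hne : (r (t * y * s) : ℂ) ≠ 0 := by exact_mod_cast (hpos _).ne'
  have h1 : HasDerivAt (fun s' : ℝ => Complex.I * t * y * (s' : ℂ) * x)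
      (Complex.I * t * y * x) s := by
    simpa using ((Complex.ofRealCLM.hasDerivAt (x := s)).const_mul
      (Complex.I * t * y)).mul_const (x : ℂ)
  have h2 : HasDerivAt (fun s' : ℝ => r (t * y * s')) (deriv r (t * y * s) * (t * y)) s := by
    have h := (hr (t * y * s)).hasDerivAt.comp s ((hasDerivAt_id s).const_mul (t * y))
    rw [mul_one] at h
    exact h
  have h3 : HasDerivAt (fun s' : ℝ => Complex.exp (Complex.I * t * y * s' * x)
      / (r (t * y * s') : ℂ)) _ s := h1.cexp.div h2.ofReal_comp hne
  rw [h3.deriv]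
  have hy' : (y : ℂ) ≠ 0 := by exact_mod_cast hy
  push_cast
  have he : Complex.I * (t * y * s) * x = Complex.I * t * y * s * x := by ring
  rw [he]
  field_simp
  linear_combination (-(t : ℂ) * (deriv r (t * y * s) : ℝ)) * Complex.I_sq

/-- For a Type I location-shift family generated by an absolutely continuous
probability measure `ν` with finite first absolute moment and real, strictly positive
characteristic function `r₀`, assuming
`∫₀ᵗ (1/y) ∫_{−1}^{1} |(d/ds)(1/r₀(ys))| ds dy < ∞` for every `t > 0`, the kernel
`K₁†(t,x) = (1/(2π)) ∫₀¹ ∫_{−1}^{1} (1/(i y)) (d/ds)[exp(itysx)/r₀(tys)] ds dy` satisfies,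
for every `μ` with `∫ |x| dF_μ(x) < ∞` and every `t`,
`∫ K₁†(t,x) dF_μ(x) = (1/(2π)) ∫₀ᵗ (∫_{−1}^{1} μ exp(iysμ) ds) dy`. -/
theorem matching_kernel_onesided_null_locationShift
    (ν : Measure ℝ) [IsProbabilityMeasure ν]
    (hν_ac : ν ≪ volume)
    (hν_moment : Integrable (fun x : ℝ => |x|) ν)
    (r₀ : ℝ → ℝ)
    (hr₀_pos : ∀ t : ℝ, 0 < r₀ t)
    (hr₀_cf : ∀ t : ℝ, (∫ x, Complex.exp (Complex.I * (t : ℂ) * (x : ℂ)) ∂ν) = ((r₀ t : ℝ) : ℂ))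
    (F : ℝ → Measure ℝ)
    (hF : ∀ μ : ℝ, F μ = Measure.map (fun x => x + μ) ν)
    (hcond : ∀ t : ℝ, 0 < t →
      IntervalIntegrable
        (fun y => (1 / y) * ∫ s in (-1:ℝ)..(1:ℝ),
          |deriv (fun s' : ℝ => 1 / r₀ (y * s')) s|)
        volume 0 t)
    (K₁dag : ℝ → ℝ → ℂ)
    (hK₁dag : ∀ t x, K₁dag t x
      = (1 / (2 * (π : ℂ))) * ∫ y in (0:ℝ)..(1:ℝ), ∫ s in (-1:ℝ)..(1:ℝ),
          (1 / (Complex.I * (y : ℂ))) *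
            deriv (fun s' : ℝ =>
              Complex.exp (Complex.I * (t : ℂ) * (y : ℂ) * (s' : ℂ) * (x : ℂ))
                / ((r₀ (t * y * s') : ℝ) : ℂ)) s) :
    ∀ μ : ℝ, Integrable (fun x : ℝ => |x|) (F μ) →
      ∀ t : ℝ,
        (∫ x, K₁dag t x ∂(F μ))
          = (1 / (2 * (π : ℂ))) * ∫ y in (0:ℝ)..t, ∫ s in (-1:ℝ)..(1:ℝ),
              (μ : ℂ) * Complex.exp (Complex.I * (y : ℂ) * (s : ℂ) * (μ : ℂ)) := by
  intro μ hμ t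
  have hcf : ∀ u, charFun ν u = (r₀ u : ℂ) := fun u => by
    rw [charFun_apply_real, ← hr₀_cf]
    congr with x
    ring_nf
  have hC1 : ContDiff ℝ 1 r₀ := contDiff_one_of_charFun_eq_ofReal hν_moment hcf
  have hdiff : Differentiable ℝ r₀ := hC1.differentiable one_ne_zero
  have hcr : Continuous r₀ := hC1.continuous
  have hcd : Continuous (deriv r₀) := hC1.continuous_deriv le_rfl
  have hprob : IsProbabilityMeasure (F μ) := by
    rw [hF]
    exact Measure.isProbabilityMeasure_map (by fun_prop)
  have hcfF : ∀ u : ℝ, charFun (F μ) u = Complex.exp (Complex.I * u * μ) * r₀ u := fun u => by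
    rw [hF, charFun_map_add_const, hcf, mul_comm]
    congr 2
    simp
    ring
  have hne : ∀ u, (r₀ u : ℂ) ≠ 0 := fun u => by exact_mod_cast (hr₀_pos u).ne'
  let b : ℝ → ℝ → ℂ := fun u x => Complex.exp (Complex.I * u * x)
    * ((x : ℂ) / r₀ u + Complex.I * (deriv r₀ u : ℝ) / (r₀ u : ℂ) ^ 2)
  have hb : Continuous b.uncurry := by
    simp only [b, Function.uncurry_def]
    fun_prop (disch := simp [hne])
  obtain ⟨C, hC⟩ : ∃ C : ℝ, ∀ u ∈ Set.Icc (-|t|) |t|, ∀ x,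
      ‖b u x‖ ≤ C * (1 + |x|) := by
    have hA : Continuous fun u => (r₀ u)⁻¹ := hcr.inv₀ fun u => (hr₀_pos u).ne'
    have hB : Continuous fun u => Complex.I * (deriv r₀ u : ℝ) / (r₀ u : ℂ) ^ 2 := by
      fun_prop (disch := simp [hne])
    obtain ⟨A, hA⟩ := (isCompact_Icc (a := -|t|) (b := |t|)).exists_bound_of_continuousOn
      hA.continuousOn
    obtain ⟨B, hB⟩ := (isCompact_Icc (a := -|t|) (b := |t|)).exists_bound_of_continuousOn
      hB.continuousOn
    have h0 : (0 : ℝ) ∈ Set.Icc (-|t|) |t| := by simp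
    have hA0 : 0 ≤ A := (norm_nonneg _).trans (hA 0 h0)
    have hB0 : 0 ≤ B := (norm_nonneg _).trans (hB 0 h0)
    refine ⟨A + B, fun u hu x => ?_⟩
    have hexp : ‖Complex.exp (Complex.I * u * x)‖ = 1 := by
      rw [mul_assoc, mul_comm, ← Complex.ofReal_mul, Complex.norm_exp_ofReal_mul_I]
    have hx : ‖(x : ℂ) / r₀ u‖ ≤ A * |x| := by
      have := hA u hu
      rw [div_eq_mul_inv, norm_mul, ← Complex.ofReal_inv, Complex.norm_real, Complex.norm_real,
        Real.norm_eq_abs, mul_comm]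
      gcongr
    calc ‖b u x‖ ≤ A * |x| + B := by
          rw [norm_mul, hexp, one_mul]
          exact (norm_add_le _ _).trans (add_le_add hx (hB u hu))
      _ ≤ (A + B) * (1 + |x|) := by nlinarith [abs_nonneg x, mul_nonneg hB0 (abs_nonneg x)]
  have hmem : ∀ y ∈ Set.uIoc (0 : ℝ) 1, ∀ s ∈ Set.uIoc (-1 : ℝ) 1,
      t * y * s ∈ Set.Icc (-|t|) |t| := by
    intro y hy s hs
    rw [Set.uIoc_of_le (by norm_num)] at hy hs
    rw [Set.mem_Icc, ← abs_le, abs_mul, abs_mul]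
    have hy1 : |y| ≤ 1 := abs_le.2 ⟨by linarith [hy.1], hy.2⟩
    have hs1 : |s| ≤ 1 := abs_le.2 ⟨hs.1.le, hs.2⟩
    calc |t| * |y| * |s| ≤ |t| * 1 * 1 := by gcongr
      _ = |t| := by ring
  have hK : ∀ x, K₁dag t x = (1 / (2 * (π : ℂ)))
      * ((t : ℂ) * ∫ y in (0:ℝ)..1, ∫ s in (-1:ℝ)..1, b (t * y * s) x) := by
    intro x
    rw [hK₁dag]
    congr 1
    rw [← intervalIntegral.integral_const_mul]
    refine intervalIntegral.integral_congr_ae (.of_forall fun y hy => ?_)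
    rw [Set.uIoc_of_le zero_le_one] at hy
    rw [← intervalIntegral.integral_const_mul]
    congr with s
    exact deriv_exp_div_charFun hdiff hr₀_pos t x s hy.1.ne'
  have hcont : Continuous (fun p : (ℝ × ℝ) × ℝ => b (t * p.1.1 * p.2) p.1.2) :=
    hb.comp (f := fun p : (ℝ × ℝ) × ℝ => (t * p.1.1 * p.2, p.1.2)) (by fun_prop)
  have hswap : ∫ x, (∫ y in (0:ℝ)..1, ∫ s in (-1:ℝ)..1, b (t * y * s) x) ∂(F μ)
      = ∫ y in (0:ℝ)..1, ∫ s in (-1:ℝ)..1, (∫ x, b (t * y * s) x ∂(F μ)) := by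
    rw [integral_intervalIntegral_comm_of_continuous_of_norm_le (C := 2 * C) hμ
      (intervalIntegral.continuous_parametric_intervalIntegral_of_continuous' hcont _ _)]
    · refine intervalIntegral.integral_congr_ae (.of_forall fun y hy => ?_)
      exact integral_intervalIntegral_comm_of_continuous_of_norm_le hμ
        (g := fun s x => b (t * y * s) x)
        (hb.comp (f := fun p : ℝ × ℝ => (t * y * p.1, p.2)) (by fun_prop))
        fun s hs x => hC _ (hmem y hy s hs) x
    · intro y hy x
      refine (intervalIntegral.norm_integral_le_of_norm_le_const
        fun s hs => hC _ (hmem y hy s hs) x).trans_eq ?_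
      norm_num
      ring
  simp only [hK]
  rw [integral_const_mul, integral_const_mul, hswap]
  congr 1
  have hinner : ∀ u : ℝ, ∫ x, b u x ∂(F μ) = (μ : ℂ) * Complex.exp (Complex.I * u * μ) :=
    fun u => integral_exp_mul_of_charFun_eq hμ hdiff hcfF (hr₀_pos u).ne'
  simp only [hinner]
  have hscale := intervalIntegral.smul_integral_comp_mul_left (a := 0) (b := 1)
    (fun y : ℝ => ∫ s in (-1:ℝ)..1,
      (μ : ℂ) * Complex.exp (Complex.I * (y : ℂ) * (s : ℂ) * (μ : ℂ))) t
  rw [mul_zero, mul_one, Complex.real_smul] at hscale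
  rw [← hscale]
  push_cast
  simp only [mul_assoc]
end

section
/- Let a < b and t be real numbers, and define for x > 0 the kernel K₁(t,x) = (t/(2π)) ∫_a^b ∫_{−1}^{1} [ Σ_{n=0}^{∞} Γ(σ) (t s x σ)ⁿ cos(nπ/2 − t s y)/(n! Γ(n+σ)) ] ds dy. Then ∫ K₁(t,x) dG_θ(x) = (1/(2π)) ∫_a^b t ( ∫_{−1}^{1} exp(i t s (σ/(1−θ) − y)) ds ) dy = (1/π) ∫_{(μ(θ)−b)t}^{(μ(θ)−a)t} (sin v)/v dv, where μ(θ) = σ/(1−θ) and the integrand (sin v)/v is extended by the value 1 at v = 0. -/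
open MeasureTheory Real

theorem abs_pow_mul_cos_le (t y : ℝ) {s : ℝ} (hs : s ∈ Set.uIoc (-1 : ℝ) 1) (n : ℕ) :
    |(t * s) ^ n * Real.cos ((n : ℝ) * π / 2 - t * s * y)| ≤ |t| ^ n := by
  rw [Set.uIoc_of_le (by norm_num)] at hs
  have hs' : |s| ≤ 1 := abs_le.2 ⟨hs.1.le, hs.2⟩
  have h1 : |t * s| ^ n ≤ |t| ^ n := by
    rw [abs_mul]
    gcongr
    exact mul_le_of_le_one_right (abs_nonneg t) hs'
  rw [abs_mul, abs_pow]
  exact (mul_le_of_le_one_right (by positivity) (Real.abs_cos_le_one _)).trans h1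

/-- If `∑ |dₙ| |t|ⁿ` converges, the double integral of `∑ dₙ (ts)ⁿ cos (nπ/2 - tsy)` over
`y ∈ [a, b]`, `s ∈ [-1, 1]` may be computed term by term. -/
theorem hasSum_intervalIntegral_cos_series (a b t : ℝ) (d : ℕ → ℝ)
    (hd : Summable fun n => |d n| * |t| ^ n) :
    HasSum (fun n : ℕ => d n * ∫ y in a..b, ∫ s in (-1 : ℝ)..1,
        (t * s) ^ n * Real.cos ((n : ℝ) * π / 2 - t * s * y))
      (∫ y in a..b, ∫ s in (-1 : ℝ)..1,
        ∑' n : ℕ, d n * ((t * s) ^ n * Real.cos ((n : ℝ) * π / 2 - t * s * y))) := by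
  have hbound : ∀ (n : ℕ) (y s : ℝ), s ∈ Set.uIoc (-1 : ℝ) 1 →
      ‖d n * ((t * s) ^ n * Real.cos ((n : ℝ) * π / 2 - t * s * y))‖ ≤ |d n| * |t| ^ n := by
    intro n y s hs
    rw [Real.norm_eq_abs, abs_mul]
    exact mul_le_mul_of_nonneg_left (abs_pow_mul_cos_le t y hs n) (abs_nonneg _)
  have hinner : ∀ y : ℝ, HasSum
      (fun n : ℕ => ∫ s in (-1 : ℝ)..1,
        d n * ((t * s) ^ n * Real.cos ((n : ℝ) * π / 2 - t * s * y)))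
      (∫ s in (-1 : ℝ)..1,
        ∑' n : ℕ, d n * ((t * s) ^ n * Real.cos ((n : ℝ) * π / 2 - t * s * y))) := by
    intro y
    refine intervalIntegral.hasSum_integral_of_dominated_convergence
      (fun n _ => |d n| * |t| ^ n) (fun n => ?_) (fun n => ?_) ?_ ?_ ?_
    · exact Continuous.aestronglyMeasurable (by fun_prop)
    · exact Filter.Eventually.of_forall fun s hs => hbound n y s hs
    · exact Filter.Eventually.of_forall fun _ _ => hd
    · exact intervalIntegrable_const
    · exact Filter.Eventually.of_forall fun s hs =>
        (Summable.of_norm_bounded hd fun n => hbound n y s hs).hasSum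
  have houter : HasSum
      (fun n : ℕ => ∫ y in a..b, ∫ s in (-1 : ℝ)..1,
        d n * ((t * s) ^ n * Real.cos ((n : ℝ) * π / 2 - t * s * y)))
      (∫ y in a..b, ∫ s in (-1 : ℝ)..1,
        ∑' n : ℕ, d n * ((t * s) ^ n * Real.cos ((n : ℝ) * π / 2 - t * s * y))) := by
    refine intervalIntegral.hasSum_integral_of_dominated_convergence
      (fun n _ => |d n| * |t| ^ n * |(1 : ℝ) - (-1)|) (fun n => ?_) (fun n => ?_) ?_ ?_ ?_
    · refine Continuous.aestronglyMeasurable ?_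
      refine intervalIntegral.continuous_parametric_intervalIntegral_of_continuous'
        (f := fun y s => d n * ((t * s) ^ n * Real.cos ((n : ℝ) * π / 2 - t * s * y))) ?_ _ _
      simp only [Function.uncurry_def]
      fun_prop
    · exact Filter.Eventually.of_forall fun y _ =>
        intervalIntegral.norm_integral_le_of_norm_le_const fun s hs => hbound n y s hs
    · exact Filter.Eventually.of_forall fun _ _ => hd.mul_right _
    · exact intervalIntegrable_const
    · exact Filter.Eventually.of_forall fun y _ => hinner y
  simpa only [intervalIntegral.integral_const_mul] using houter

theorem abs_intervalIntegral_pow_mul_cos_le (a b t : ℝ) (n : ℕ) :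
    |∫ y in a..b, ∫ s in (-1 : ℝ)..1, (t * s) ^ n * Real.cos ((n : ℝ) * π / 2 - t * s * y)|
      ≤ |t| ^ n * 2 * |b - a| := by
  have hinner : ∀ y : ℝ,
      ‖∫ s in (-1 : ℝ)..1, (t * s) ^ n * Real.cos ((n : ℝ) * π / 2 - t * s * y)‖
        ≤ |t| ^ n * 2 := by
    intro y
    have h := intervalIntegral.norm_integral_le_of_norm_le_const
      (f := fun s => (t * s) ^ n * Real.cos ((n : ℝ) * π / 2 - t * s * y))
      fun s hs => abs_pow_mul_cos_le t y hs n
    norm_num at h ⊢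
    exact h
  exact intervalIntegral.norm_integral_le_of_norm_le_const
    (f := fun y => ∫ s in (-1 : ℝ)..1, (t * s) ^ n * Real.cos ((n : ℝ) * π / 2 - t * s * y))
    fun y _ => hinner y

theorem summable_pow_div_factorial_mul_Gamma {σ : ℝ} (hσ : 0 < σ) (X : ℝ) :
    Summable fun n : ℕ => X ^ n / ((n.factorial : ℝ) * Real.Gamma (n + σ)) := by
  refine summable_of_ratio_norm_eventually_le (r := 1 / 2) (by norm_num) ?_
  obtain ⟨N, hN⟩ := exists_nat_ge (2 * |X| / σ)
  filter_upwards [Filter.eventually_ge_atTop N] with n hn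
  have hnσ : 0 < (n : ℝ) + σ := by positivity
  have hG := Real.Gamma_pos_of_pos hnσ
  have hrec : Real.Gamma (((n + 1 : ℕ) : ℝ) + σ) = (n + σ) * Real.Gamma (n + σ) := by
    rw [← Real.Gamma_add_one hnσ.ne']
    push_cast
    ring_nf
  have hfac : (0 : ℝ) < n.factorial := by positivity
  have heq : X ^ (n + 1) / (((n + 1).factorial : ℝ) * Real.Gamma (((n + 1 : ℕ) : ℝ) + σ))
      = X / ((n + 1) * (n + σ)) * (X ^ n / ((n.factorial : ℝ) * Real.Gamma (n + σ))) := by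
    rw [hrec, Nat.factorial_succ]
    push_cast
    field_simp
    ring
  rw [heq, norm_mul]
  gcongr
  have hpos : 0 < ((n : ℝ) + 1) * (n + σ) := by positivity
  rw [Real.norm_eq_abs, abs_div, abs_of_pos hpos, div_le_iff₀ hpos]
  have h1 : 2 * |X| ≤ n * σ := by
    rw [← div_le_iff₀ hσ]
    exact hN.trans (by exact_mod_cast hn)
  have h0 : (0 : ℝ) ≤ n := n.cast_nonneg
  nlinarith [mul_nonneg h0 h0]

theorem tsum_pow_div_factorial_mul_cos (u φ : ℝ) :
    ∑' n : ℕ, u ^ n / (n.factorial : ℝ) * Real.cos ((n : ℝ) * π / 2 - φ) = Real.cos (u - φ) := by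
  have h := (NormedSpace.expSeries_div_hasSum_exp ((u : ℂ) * Complex.I)).mul_right
    (Complex.exp (-φ * Complex.I))
  rw [← Complex.exp_eq_exp_ℂ, ← Complex.exp_add] at h
  have hre := Complex.hasSum_re h
  have hval : (Complex.exp (u * Complex.I + -φ * Complex.I)).re = Real.cos (u - φ) := by
    rw [← Complex.exp_ofReal_mul_I_re]
    push_cast
    ring_nf
  rw [hval] at hre
  refine (HasSum.tsum_eq ?_)
  convert hre using 2 with n
  have hI : Complex.I ^ n = Complex.exp ((n : ℂ) * (π / 2 * Complex.I)) := by
    rw [Complex.exp_nat_mul, Complex.exp_pi_div_two_mul_I]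
  have : ((u : ℂ) * Complex.I) ^ n / (n.factorial : ℂ) * Complex.exp (-φ * Complex.I)
      = ((u ^ n / (n.factorial : ℝ) : ℝ) : ℂ)
        * Complex.exp (((n : ℝ) * π / 2 - φ : ℝ) * Complex.I) := by
    have hsplit : (((n : ℝ) * π / 2 - φ : ℝ) : ℂ) * Complex.I
        = (n : ℂ) * (π / 2 * Complex.I) + -φ * Complex.I := by
      push_cast
      ring
    rw [hsplit, Complex.exp_add, ← hI, mul_pow]
    push_cast
    ring
  rw [this, Complex.re_ofReal_mul, Complex.exp_ofReal_mul_I_re]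

/-- The moments of the Gamma family, together with a.e. positivity and integrability. -/
theorem gammaFamily_moment {σ θ : ℝ} (hσ : 0 < σ) (hθ : θ < 1) {G : Measure ℝ}
    (hG : G = volume.withDensity (fun x : ℝ => ENNReal.ofReal
      (if 0 < x then (1 - θ)^σ * Real.exp (θ * x) * x^(σ - 1) * Real.exp (-x) / Real.Gamma σ
       else 0))) :
    (∀ᵐ x ∂G, 0 < x) ∧ ∀ n : ℕ, Integrable (fun x => x ^ n) G ∧
      ∫ x, x ^ n ∂G = Real.Gamma (n + σ) / (Real.Gamma σ * (1 - θ) ^ n) := by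
  have hθ' : 0 < 1 - θ := by linarith
  have hΓ := Real.Gamma_pos_of_pos hσ
  have hmeas : Measurable (fun x : ℝ => ENNReal.ofReal
      (if 0 < x then (1 - θ)^σ * Real.exp (θ * x) * x^(σ - 1) * Real.exp (-x) / Real.Gamma σ
       else 0)) := by
    refine ENNReal.measurable_ofReal.comp (Measurable.ite measurableSet_Ioi ?_ measurable_const)
    fun_prop
  refine ⟨?_, fun n => ?_⟩
  · rw [hG, ae_withDensity_iff hmeas]
    refine Filter.Eventually.of_forall fun x hx => ?_
    by_contra hx0
    simp [hx0] at hx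
  · have hval : ∫ x, x ^ n ∂G = Real.Gamma (n + σ) / (Real.Gamma σ * (1 - θ) ^ n) := by
      rw [hG, integral_withDensity_eq_integral_toReal_smul hmeas
        (Filter.Eventually.of_forall fun _ => ENNReal.ofReal_lt_top)]
      have hfun : ∀ x : ℝ, (ENNReal.ofReal (if 0 < x then
            (1 - θ)^σ * Real.exp (θ * x) * x^(σ - 1) * Real.exp (-x) / Real.Gamma σ
            else 0)).toReal • x ^ n
          = (Set.Ioi (0 : ℝ)).indicator (fun x => (1 - θ) ^ σ / Real.Gamma σ *
            (x ^ ((n + σ) - 1) * Real.exp (-((1 - θ) * x)))) x := by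
        intro x
        by_cases hx : 0 < x
        · have hexp : Real.exp (-((1 - θ) * x)) = Real.exp (θ * x) * Real.exp (-x) := by
            rw [← Real.exp_add]
            ring_nf
          have hpow : x ^ (((n : ℝ) + σ) - 1) = x ^ n * x ^ (σ - 1) := by
            rw [← Real.rpow_natCast, ← Real.rpow_add hx]
            ring_nf
          rw [Set.indicator_of_mem (Set.mem_Ioi.2 hx), if_pos hx,
            ENNReal.toReal_ofReal (by positivity), hexp, hpow, smul_eq_mul]
          ring
        · simp [hx]
      simp_rw [hfun]
      rw [integral_indicator measurableSet_Ioi, integral_const_mul,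
        integral_rpow_mul_exp_neg_mul_Ioi (by positivity) hθ', one_div,
        Real.inv_rpow hθ'.le, Real.rpow_add hθ', Real.rpow_natCast]
      have := (Real.rpow_pos_of_pos hθ' σ).ne'
      field_simp
    refine ⟨Integrable.of_integral_ne_zero ?_, hval⟩
    rw [hval]
    have := Real.Gamma_pos_of_pos (show 0 < (n : ℝ) + σ by positivity)
    positivity

theorem intervalIntegral_cos_mul_eq_sinc (c : ℝ) :
    ∫ s in (-1 : ℝ)..1, Real.cos (c * s) = 2 * Real.sinc c := by
  rcases eq_or_ne c 0 with rfl | hc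
  · norm_num
  · rw [intervalIntegral.integral_comp_mul_left _ hc, integral_cos, Real.sinc_of_ne_zero hc]
    simp only [mul_one, mul_neg, Real.sin_neg, smul_eq_mul]
    field_simp
    ring

theorem intervalIntegral_cexp_eq_cos (c : ℝ) :
    ∫ s in (-1 : ℝ)..1, Complex.exp (((c * s : ℝ) : ℂ) * Complex.I)
      = ((∫ s in (-1 : ℝ)..1, Real.cos (c * s) : ℝ) : ℂ) := by
  have hodd : ∫ s in (-1 : ℝ)..1, Real.sin (c * s) = 0 := by
    have h := intervalIntegral.integral_comp_neg (a := -1) (b := 1) fun s => Real.sin (c * s)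
    simp only [mul_neg, Real.sin_neg, intervalIntegral.integral_neg, neg_neg] at h
    linarith
  have hsplit : ∀ s : ℝ, Complex.exp (((c * s : ℝ) : ℂ) * Complex.I)
      = ((Real.cos (c * s) : ℝ) : ℂ) + ((Real.sin (c * s) : ℝ) : ℂ) * Complex.I := by
    intro s
    rw [Complex.exp_mul_I, ← Complex.ofReal_cos, ← Complex.ofReal_sin]
  simp_rw [hsplit]
  rw [intervalIntegral.integral_add (Continuous.intervalIntegrable (by fun_prop) _ _)
      (Continuous.intervalIntegrable (by fun_prop) _ _),
    intervalIntegral.integral_mul_const, intervalIntegral.integral_ofReal,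
    intervalIntegral.integral_ofReal, hodd]
  simp

/-- Integrating `K₁(t, ·)` against the Gamma family replaces the series by a cosine. -/
theorem integral_gammaFamily_kernel {σ θ : ℝ} (hσ : 0 < σ) (hθ : θ < 1) {G : Measure ℝ}
    (hG : G = volume.withDensity (fun x : ℝ => ENNReal.ofReal
      (if 0 < x then (1 - θ)^σ * Real.exp (θ * x) * x^(σ - 1) * Real.exp (-x) / Real.Gamma σ
       else 0))) (a b t : ℝ) :
    ∫ x, (∫ y in a..b, ∫ s in (-1:ℝ)..(1:ℝ),
        ∑' n : ℕ, Real.Gamma σ * (t * s * x * σ)^n * Real.cos ((n : ℝ) * π / 2 - t * s * y)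
          / ((n.factorial : ℝ) * Real.Gamma ((n : ℝ) + σ))) ∂G
      = ∫ y in a..b, ∫ s in (-1:ℝ)..(1:ℝ), Real.cos (t * (σ / (1 - θ) - y) * s) := by
  obtain ⟨hpos, hmom⟩ := gammaFamily_moment hσ hθ hG
  have hθ' : 0 < 1 - θ := by linarith
  have hΓ := Real.Gamma_pos_of_pos hσ
  have hΓn : ∀ n : ℕ, 0 < Real.Gamma ((n : ℝ) + σ) := fun n =>
    Real.Gamma_pos_of_pos (by positivity)
  set A : ℕ → ℝ := fun n => ∫ y in a..b, ∫ s in (-1 : ℝ)..1,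
    (t * s) ^ n * Real.cos ((n : ℝ) * π / 2 - t * s * y) with hA
  set c : ℕ → ℝ := fun n =>
    Real.Gamma σ * σ ^ n / ((n.factorial : ℝ) * Real.Gamma ((n : ℝ) + σ)) with hc
  have hc0 : ∀ n, 0 ≤ c n := fun n => by
    have := hΓn n
    positivity
  have hexpand : ∀ x : ℝ, (∫ y in a..b, ∫ s in (-1:ℝ)..(1:ℝ),
        ∑' n : ℕ, Real.Gamma σ * (t * s * x * σ)^n * Real.cos ((n : ℝ) * π / 2 - t * s * y)
          / ((n.factorial : ℝ) * Real.Gamma ((n : ℝ) + σ)))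
      = ∑' n : ℕ, c n * A n * x ^ n := by
    intro x
    have hsum : Summable fun n => |c n * x ^ n| * |t| ^ n := by
      refine ((summable_pow_div_factorial_mul_Gamma hσ (σ * |x| * |t|)).mul_left
        (Real.Gamma σ)).congr fun n => ?_
      rw [abs_mul, abs_of_nonneg (hc0 n), abs_pow, hc]
      simp only [mul_pow]
      ring
    have h := (hasSum_intervalIntegral_cos_series a b t _ hsum).tsum_eq
    calc _ = ∫ y in a..b, ∫ s in (-1 : ℝ)..1, ∑' n : ℕ,
          c n * x ^ n * ((t * s) ^ n * Real.cos ((n : ℝ) * π / 2 - t * s * y)) := by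
          congr! 6 with y s n
          simp only [hc, mul_pow]
          ring
      _ = _ := by
          rw [← h]
          congr! 2 with n
          ring
  have hcm : ∀ n, c n * ∫ x, x ^ n ∂G = (σ / (1 - θ)) ^ n / (n.factorial : ℝ) := by
    intro n
    have := (hΓn n).ne'
    rw [(hmom n).2, hc, div_pow]
    field_simp
  have hint : HasSum (fun n => ∫ x, c n * A n * x ^ n ∂G) (∫ x, ∑' n, c n * A n * x ^ n ∂G) := by
    refine hasSum_integral_of_summable_integral_norm
      (fun n => (hmom n).1.const_mul _) ?_
    have hnorm : ∀ n, ∫ x, ‖c n * A n * x ^ n‖ ∂G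
        = |A n| * ((σ / (1 - θ)) ^ n / (n.factorial : ℝ)) := by
      intro n
      rw [← hcm n, ← integral_const_mul, ← integral_const_mul]
      refine integral_congr_ae ?_
      filter_upwards [hpos] with x hx
      rw [Real.norm_eq_abs, abs_mul, abs_mul, abs_of_nonneg (hc0 n),
        abs_of_nonneg (by positivity : 0 ≤ x ^ n)]
      ring
    simp_rw [hnorm]
    refine Summable.of_nonneg_of_le (fun n => by positivity) (fun n => ?_)
      ((Real.summable_pow_div_factorial (|t| * (σ / (1 - θ)))).mul_left (2 * |b - a|))
    calc |A n| * ((σ / (1 - θ)) ^ n / (n.factorial : ℝ))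
        ≤ |t| ^ n * 2 * |b - a| * ((σ / (1 - θ)) ^ n / (n.factorial : ℝ)) := by
          gcongr
          exact abs_intervalIntegral_pow_mul_cos_le a b t n
      _ = _ := by
          rw [mul_pow]
          ring
  have hsum' : Summable fun n : ℕ => |(σ / (1 - θ)) ^ n / (n.factorial : ℝ)| * |t| ^ n := by
    refine (Real.summable_pow_div_factorial (σ / (1 - θ) * |t|)).congr fun n => ?_
    rw [abs_of_nonneg (by positivity : 0 ≤ (σ / (1 - θ)) ^ n / (n.factorial : ℝ)), mul_pow]
    ring
  have hback := (hasSum_intervalIntegral_cos_series a b t _ hsum').tsum_eq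
  simp_rw [hexpand]
  rw [← hint.tsum_eq]
  calc ∑' n, ∫ x, c n * A n * x ^ n ∂G
      = ∑' n : ℕ, (σ / (1 - θ)) ^ n / (n.factorial : ℝ) * A n := by
        congr! 2 with n
        rw [integral_const_mul, ← hcm n]
        ring
    _ = _ := hback
    _ = _ := by
        congr! 4 with y s
        rw [show t * (σ / (1 - θ) - y) * s = t * s * (σ / (1 - θ)) - t * s * y by ring,
          ← tsum_pow_div_factorial_mul_cos]
        congr! 2 with n
        rw [mul_pow]
        ring

/-- For the Gamma family `G_θ` (shape `σ > 0`, natural parameter `θ < 1`,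
mean `μ(θ) = σ/(1−θ)`), the kernel
`K₁(t,x) = (t/(2π)) ∫_a^b ∫_{−1}^{1} Σₙ Γ(σ)(tsxσ)ⁿ cos(nπ/2 − tsy)/(n!Γ(n+σ)) ds dy`
satisfies `∫ K₁(t,x) dG_θ(x) = (1/(2π)) ∫_a^b t (∫_{−1}^{1} exp(its(σ/(1−θ)−y)) ds) dy
= (1/π) ∫_{(μ(θ)−b)t}^{(μ(θ)−a)t} (sin v)/v dv`, the integrand `(sin v)/v` being extended
by `1` at `v = 0`. -/
theorem matching_kernel_bounded_null_gamma
    (σ θ : ℝ) (hσ : 0 < σ) (hθ : θ < 1)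
    (G : Measure ℝ)
    (hG : G = volume.withDensity (fun x : ℝ => ENNReal.ofReal
      (if 0 < x then (1 - θ)^σ * Real.exp (θ * x) * x^(σ - 1) * Real.exp (-x) / Real.Gamma σ
       else 0)))
    (a b t : ℝ) (hab : a < b)
    (K₁ : ℝ → ℝ → ℝ)
    (hK₁ : ∀ t x, K₁ t x
      = (t / (2 * π)) * ∫ y in a..b, ∫ s in (-1:ℝ)..(1:ℝ),
          ∑' n : ℕ, Real.Gamma σ * (t * s * x * σ)^n * Real.cos ((n : ℝ) * π / 2 - t * s * y)
            / ((n.factorial : ℝ) * Real.Gamma ((n : ℝ) + σ))) :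
    ((∫ x, K₁ t x ∂G : ℝ) : ℂ)
        = (1 / (2 * (π : ℂ))) * ∫ y in a..b,
            (t : ℂ) * ∫ s in (-1:ℝ)..(1:ℝ),
              Complex.exp (Complex.I * (t : ℂ) * (s : ℂ) * (((σ / (1 - θ) : ℝ) : ℂ) - (y : ℂ)))
      ∧ (∫ x, K₁ t x ∂G)
        = (1/π) * ∫ v in ((σ / (1 - θ) - b) * t)..((σ / (1 - θ) - a) * t),
            if v = 0 then (1:ℝ) else Real.sin v / v := by
  have hcos : ∫ x, K₁ t x ∂G = t / (2 * π) * ∫ y in a..b, ∫ s in (-1:ℝ)..(1:ℝ),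
      Real.cos (t * (σ / (1 - θ) - y) * s) := by
    simp_rw [hK₁]
    rw [integral_const_mul, integral_gammaFamily_kernel hσ hθ hG]
  rw [hcos]
  constructor
  · have hexp : ∀ y : ℝ, (∫ s in (-1:ℝ)..(1:ℝ),
        Complex.exp (Complex.I * (t : ℂ) * (s : ℂ) * (((σ / (1 - θ) : ℝ) : ℂ) - (y : ℂ))))
        = ((∫ s in (-1 : ℝ)..1, Real.cos (t * (σ / (1 - θ) - y) * s) : ℝ) : ℂ) := by
      intro y
      rw [← intervalIntegral_cexp_eq_cos]
      congr! 3 with s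
      push_cast
      ring
    simp_rw [hexp]
    rw [intervalIntegral.integral_const_mul, intervalIntegral.integral_ofReal]
    push_cast
    ring
  · have hsub := intervalIntegral.smul_integral_comp_sub_mul (a := a) (b := b) Real.sinc t
      (σ / (1 - θ) * t)
    rw [smul_eq_mul, show σ / (1 - θ) * t - t * b = (σ / (1 - θ) - b) * t by ring,
      show σ / (1 - θ) * t - t * a = (σ / (1 - θ) - a) * t by ring] at hsub
    change _ = 1 / π * ∫ v in ((σ / (1 - θ) - b) * t)..((σ / (1 - θ) - a) * t), Real.sinc v
    simp_rw [← hsub, intervalIntegral_cos_mul_eq_sinc]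
    rw [intervalIntegral.integral_const_mul,
      show (fun y => Real.sinc (t * (σ / (1 - θ) - y)))
        = fun y => Real.sinc (σ / (1 - θ) * t - t * y) by funext y; ring_nf]
    field_simp
end

section
/- Let b and t be real numbers and define for x > 0 the kernel K₁(t,x) = (1/(2π)) ∫₀¹ t ∫_{−1}^{1} Σ_{n=0}^{∞} cos(nπ/2 − t y s b) · ((t y s)ⁿ (σ x)ⁿ/n!) · Γ(σ) (σ x/Γ(σ+n+1) − b/Γ(σ+n)) ds dy. Then ∫ K₁(t,x) dG_θ(x) = (1/(2π)) ∫₀ᵗ (σ/(1−θ) − b) ( ∫_{−1}^{1} exp(i y s (σ/(1−θ) − b)) ds ) dy = (1/π) ∫₀ᵗ sin{(μ(θ)−b) y}/y dy, where μ(θ) = σ/(1−θ) and the last integrand is extended by the value μ(θ)−b at y = 0. -/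
open MeasureTheory Real

section TsumIntegrable

variable {α : Type*} {mα : MeasurableSpace α} {μ : Measure α}

lemma integrable_tsum_of_summable_integral_norm {F : ℕ → α → ℝ} (hF : ∀ n, Integrable (F n) μ)
    (hsum : Summable fun n => ∫ a, ‖F n a‖ ∂μ) : Integrable (fun a => ∑' n, F n a) μ := by
  refine ⟨(AEMeasurable.tsum fun n => (hF n).1.aemeasurable).aestronglyMeasurable, ?_⟩
  have hle : ∫⁻ a, ‖∑' n, F n a‖ₑ ∂μ ≤ ∑' n, ∫⁻ a, ‖F n a‖ₑ ∂μ := by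
    rw [← lintegral_tsum fun n => (hF n).1.enorm]
    exact lintegral_mono fun a => enorm_tsum_le_tsum_enorm
  refine hle.trans_lt ?_
  simp_rw [← fun n => ofReal_integral_norm_eq_lintegral_enorm (hF n)]
  rw [← ENNReal.ofReal_tsum_of_nonneg (fun n => integral_nonneg fun a => norm_nonneg _) hsum]
  exact ENNReal.ofReal_lt_top

end TsumIntegrable

/-- `cos (nπ/2 - w) zⁿ / n!` sums to `cos (z - w)`. -/
lemma hasSum_cos_sub_mul_pow_div_factorial (w z : ℝ) :
    HasSum (fun n : ℕ => cos (n * π / 2 - w) * (z ^ n / n.factorial)) (cos (z - w)) := by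
  have h := Complex.hasSum_re ((NormedSpace.expSeries_div_hasSum_exp (z * Complex.I)).mul_left
    (Complex.exp (-w * Complex.I)))
  rw [← Complex.exp_eq_exp_ℂ, ← Complex.exp_add] at h
  convert h using 1
  · funext n
    have hI : Complex.I ^ n = Complex.exp (((n * π / 2 : ℝ) : ℂ) * Complex.I) := by
      have h2 := Complex.exp_nat_mul (π / 2 * Complex.I) n
      rw [Complex.exp_pi_div_two_mul_I] at h2
      rw [← h2]
      congr 1
      push_cast
      ring
    have : Complex.exp (-w * Complex.I) * ((z * Complex.I) ^ n / n.factorial)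
        = ((z ^ n / n.factorial : ℝ) : ℂ)
          * Complex.exp (((n * π / 2 - w : ℝ) : ℂ) * Complex.I) := by
      rw [mul_pow, hI]
      have : Complex.exp (((n * π / 2 - w : ℝ) : ℂ) * Complex.I)
          = Complex.exp (((n * π / 2 : ℝ) : ℂ) * Complex.I) * Complex.exp (-w * Complex.I) := by
        rw [← Complex.exp_add]
        congr 1
        push_cast
        ring
      rw [this]
      push_cast
      ring
    rw [this, Complex.re_ofReal_mul, Complex.exp_ofReal_mul_I_re, mul_comm]
  · have : (-w * Complex.I + z * Complex.I : ℂ) = ((z - w : ℝ) : ℂ) * Complex.I := by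
      push_cast
      ring
    rw [this, Complex.exp_ofReal_mul_I_re]

section GammaMoments

/-- The Gamma family with shape `σ` and natural parameter `θ`. -/
noncomputable def gammaFamily (σ θ : ℝ) : Measure ℝ :=
  volume.withDensity (fun x : ℝ => ENNReal.ofReal
      (if 0 < x then (1 - θ)^σ * Real.exp (θ * x) * x^(σ - 1) * Real.exp (-x) / Real.Gamma σ
       else 0))

variable {σ θ : ℝ}

instance : SFinite (gammaFamily σ θ) := by
  unfold gammaFamily
  infer_instance

lemma measurable_gammaFamily_density : Measurable (fun x : ℝ => ENNReal.ofReal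
      (if 0 < x then (1 - θ)^σ * Real.exp (θ * x) * x^(σ - 1) * Real.exp (-x) / Real.Gamma σ
       else 0)) := by
  refine (Measurable.ite measurableSet_Ioi ?_ measurable_const).ennreal_ofReal
  fun_prop

lemma ae_gammaFamily_pos : ∀ᵐ x ∂gammaFamily σ θ, 0 < x := by
  rw [gammaFamily, ae_withDensity_iff measurable_gammaFamily_density]
  refine Filter.Eventually.of_forall fun x hx => ?_
  by_contra h
  simp [h] at hx

/-- The moments of the Gamma family. -/
lemma integral_pow_gammaFamily (hσ : 0 < σ) (hθ : θ < 1) (n : ℕ) :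
    ∫ x, x ^ n ∂gammaFamily σ θ = Gamma (σ + n) / Gamma σ / (1 - θ) ^ n := by
  have hr : 0 < 1 - θ := by linarith
  have hΓ := Gamma_pos_of_pos hσ
  rw [gammaFamily, integral_withDensity_eq_integral_toReal_smul measurable_gammaFamily_density
    (Filter.Eventually.of_forall fun x => ENNReal.ofReal_lt_top)]
  have : (fun x : ℝ => (ENNReal.ofReal
      (if 0 < x then (1 - θ)^σ * Real.exp (θ * x) * x^(σ - 1) * Real.exp (-x) / Real.Gamma σ
       else 0)).toReal • x ^ n) = (Set.Ioi (0 : ℝ)).indicator (fun x : ℝ =>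
        ((1 - θ) ^ σ / Gamma σ) * (x ^ (σ + n - 1) * exp (-((1 - θ) * x)))) := by
    funext x
    by_cases hx : 0 < x
    · rw [Set.indicator_of_mem (Set.mem_Ioi.2 hx), if_pos hx, ENNReal.toReal_ofReal (by positivity)]
      have h1 : exp (-((1 - θ) * x)) = exp (θ * x) * exp (-x) := by
        rw [← exp_add]
        ring_nf
      have h2 : x ^ (σ + n - 1) = x ^ (σ - 1) * x ^ n := by
        rw [← rpow_natCast x n, ← rpow_add hx]
        ring_nf
      rw [h1, h2, smul_eq_mul]
      ring
    · rw [Set.indicator_of_notMem (by simpa using hx), if_neg hx]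
      simp
  rw [this, integral_indicator measurableSet_Ioi, integral_const_mul,
    integral_rpow_mul_exp_neg_mul_Ioi (by positivity) hr, one_div, inv_rpow hr.le, rpow_add hr,
    rpow_natCast]
  have := (rpow_pos_of_pos hr σ).ne'
  field_simp

lemma integrable_pow_gammaFamily (hσ : 0 < σ) (hθ : θ < 1) (n : ℕ) :
    Integrable (fun x => x ^ n) (gammaFamily σ θ) := by
  have hr : 0 < 1 - θ := by linarith
  have := Gamma_pos_of_pos hσ
  have := Gamma_pos_of_pos (show 0 < σ + n by positivity)
  refine .of_integral_ne_zero ?_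
  rw [integral_pow_gammaFamily hσ hθ]
  positivity

end GammaMoments

section KernelTerm

/-- The `n`-th term of the series defining the kernel, as a function of `v = t y s` and `x`. -/
noncomputable def kernelTerm (σ b : ℝ) (n : ℕ) (v x : ℝ) : ℝ :=
  Real.cos ((n : ℝ) * π / 2 - v * b)
    * (v^n * (σ * x)^n / (n.factorial : ℝ))
    * Real.Gamma σ * (σ * x / Real.Gamma (σ + (n : ℝ) + 1) - b / Real.Gamma (σ + (n : ℝ)))

/-- A bound for `kernelTerm` on `|v| ≤ T` and `0 < x`. -/
noncomputable def kernelBound (σ b T : ℝ) (n : ℕ) (x : ℝ) : ℝ :=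
  T ^ n * (σ * x) ^ n / n.factorial
    * Real.Gamma σ * (σ * x / Real.Gamma (σ + (n : ℝ) + 1) + |b| / Real.Gamma (σ + (n : ℝ)))

variable {σ θ : ℝ}

lemma integrable_and_integral_mul_affine (hσ : 0 < σ) (hθ : θ < 1) (A c : ℝ) (n : ℕ) :
    Integrable (fun x => A * (σ * x) ^ n * Gamma σ
        * (σ * x / Gamma (σ + n + 1) + c / Gamma (σ + n))) (gammaFamily σ θ)
      ∧ ∫ x, A * (σ * x) ^ n * Gamma σ
        * (σ * x / Gamma (σ + n + 1) + c / Gamma (σ + n)) ∂gammaFamily σ θ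
        = A * (σ / (1 - θ)) ^ n * (σ / (1 - θ) + c) := by
  have hr : 0 < 1 - θ := by linarith
  have h0 := Gamma_pos_of_pos hσ
  have h1 := Gamma_pos_of_pos (show 0 < σ + n by positivity)
  have h2 := Gamma_pos_of_pos (show 0 < σ + n + 1 by positivity)
  have heq : (fun x => A * (σ * x) ^ n * Gamma σ
        * (σ * x / Gamma (σ + n + 1) + c / Gamma (σ + n)))
      = fun x => A * σ ^ n * Gamma σ * σ / Gamma (σ + n + 1) * x ^ (n + 1)
        + A * σ ^ n * Gamma σ * c / Gamma (σ + n) * x ^ n := by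
    funext x
    ring
  have i1 := (integrable_pow_gammaFamily hσ hθ (n + 1)).const_mul
    (A * σ ^ n * Gamma σ * σ / Gamma (σ + n + 1))
  have i2 := (integrable_pow_gammaFamily hσ hθ n).const_mul
    (A * σ ^ n * Gamma σ * c / Gamma (σ + n))
  rw [heq]
  refine ⟨i1.add i2, ?_⟩
  rw [integral_add i1 i2, integral_const_mul, integral_const_mul, integral_pow_gammaFamily hσ hθ,
    integral_pow_gammaFamily hσ hθ, Nat.cast_add, Nat.cast_one, ← add_assoc, div_pow]
  field_simp
  ring

lemma integrable_kernelTerm (hσ : 0 < σ) (hθ : θ < 1) (b : ℝ) (n : ℕ) (v : ℝ) :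
    Integrable (kernelTerm σ b n v) (gammaFamily σ θ) := by
  convert (integrable_and_integral_mul_affine hσ hθ
    (cos (n * π / 2 - v * b) * (v ^ n / n.factorial)) (-b) n).1 using 1
  funext x
  unfold kernelTerm
  ring

lemma integral_kernelTerm (hσ : 0 < σ) (hθ : θ < 1) (b : ℝ) (n : ℕ) (v : ℝ) :
    ∫ x, kernelTerm σ b n v x ∂gammaFamily σ θ
      = cos (n * π / 2 - v * b) * ((v * (σ / (1 - θ))) ^ n / n.factorial) * (σ / (1 - θ) - b) := by
  have h := (integrable_and_integral_mul_affine hσ hθ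
    (cos (n * π / 2 - v * b) * (v ^ n / n.factorial)) (-b) n).2
  rw [mul_pow, sub_eq_add_neg]
  convert h using 1
  · refine integral_congr_ae (.of_forall fun x => ?_)
    unfold kernelTerm
    ring
  · ring_nf

lemma integrable_kernelBound (hσ : 0 < σ) (hθ : θ < 1) (b T : ℝ) (n : ℕ) :
    Integrable (kernelBound σ b T n) (gammaFamily σ θ) := by
  convert (integrable_and_integral_mul_affine hσ hθ (T ^ n / n.factorial) |b| n).1 using 1
  funext x
  unfold kernelBound
  ring

lemma integral_kernelBound (hσ : 0 < σ) (hθ : θ < 1) (b T : ℝ) (n : ℕ) :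
    ∫ x, kernelBound σ b T n x ∂gammaFamily σ θ
      = (T * (σ / (1 - θ))) ^ n / n.factorial * (σ / (1 - θ) + |b|) := by
  have h := (integrable_and_integral_mul_affine hσ hθ (T ^ n / n.factorial) |b| n).2
  rw [mul_pow]
  convert h using 1
  · refine integral_congr_ae (.of_forall fun x => ?_)
    unfold kernelBound
    ring
  · ring

lemma summable_integral_kernelBound (hσ : 0 < σ) (hθ : θ < 1) (b T : ℝ) :
    Summable fun n => ∫ x, kernelBound σ b T n x ∂gammaFamily σ θ := by
  simp_rw [integral_kernelBound hσ hθ]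
  exact (Real.summable_pow_div_factorial _).mul_right _

lemma norm_kernelTerm_le (hσ : 0 < σ) (b : ℝ) (n : ℕ) {v T x : ℝ} (hv : |v| ≤ T) (hx : 0 < x) :
    ‖kernelTerm σ b n v x‖ ≤ kernelBound σ b T n x := by
  have h0 := Gamma_pos_of_pos hσ
  have h1 := Gamma_pos_of_pos (show 0 < σ + n by positivity)
  have h2 := Gamma_pos_of_pos (show 0 < σ + n + 1 by positivity)
  have hT : 0 ≤ T := (abs_nonneg v).trans hv
  rw [kernelTerm, kernelBound, norm_mul, norm_mul, norm_mul, norm_of_nonneg h0.le]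
  refine mul_le_mul (mul_le_mul_of_nonneg_right ?_ h0.le) ?_ (norm_nonneg _) (by positivity)
  · rw [← one_mul (T ^ n * (σ * x) ^ n / n.factorial)]
    refine mul_le_mul (abs_cos_le_one _) ?_ (norm_nonneg _) zero_le_one
    rw [norm_div, norm_mul, norm_pow, norm_pow, norm_eq_abs v,
      norm_of_nonneg (show 0 ≤ σ * x by positivity), norm_natCast]
    gcongr
  · refine (norm_sub_le _ _).trans_eq ?_
    rw [norm_div, norm_div, norm_of_nonneg h1.le, norm_of_nonneg h2.le,
      norm_of_nonneg (show 0 ≤ σ * x by positivity), norm_eq_abs]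

lemma measurable_kernelTerm (σ b : ℝ) (n : ℕ) :
    Measurable fun z : ℝ × ℝ => kernelTerm σ b n z.2 z.1 := by
  unfold kernelTerm
  fun_prop

/-- Integrating the series defining the kernel term by term. -/
lemma integral_tsum_kernelTerm (hσ : 0 < σ) (hθ : θ < 1) (b v : ℝ) :
    ∫ x, ∑' n, kernelTerm σ b n v x ∂gammaFamily σ θ
      = (σ / (1 - θ) - b) * cos (v * (σ / (1 - θ) - b)) := by
  have hs : Summable fun n => ∫ x, ‖kernelTerm σ b n v x‖ ∂gammaFamily σ θ := by
    refine (summable_integral_kernelBound hσ hθ b |v|).of_nonneg_of_le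
      (fun n => integral_nonneg fun x => norm_nonneg _) fun n => ?_
    refine integral_mono_ae (integrable_kernelTerm hσ hθ b n v).norm
      (integrable_kernelBound hσ hθ b _ n) ?_
    filter_upwards [ae_gammaFamily_pos] with x hx using norm_kernelTerm_le hσ b n le_rfl hx
  rw [← integral_tsum_of_summable_integral_norm (integrable_kernelTerm hσ hθ b · v) hs]
  simp_rw [integral_kernelTerm hσ hθ]
  rw [((hasSum_cos_sub_mul_pow_div_factorial (v * b) (v * (σ / (1 - θ)))).mul_right _).tsum_eq,
    mul_comm, mul_sub v]

lemma integrable_tsum_kernelTerm_prod {β : Type*} [MeasurableSpace β] {ν : Measure β}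
    [IsFiniteMeasure ν] (hσ : 0 < σ) (hθ : θ < 1) (b : ℝ) {T : ℝ} {v : β → ℝ} (hv : Measurable v)
    (hvT : ∀ᵐ q ∂ν, |v q| ≤ T) :
    Integrable (fun z : ℝ × β => ∑' n, kernelTerm σ b n (v z.2) z.1)
      ((gammaFamily σ θ).prod ν) := by
  have hB n := (integrable_kernelBound (θ := θ) hσ hθ b T n).comp_fst ν
  have hle : ∀ n, ∀ᵐ z ∂(gammaFamily σ θ).prod ν,
      ‖kernelTerm σ b n (v z.2) z.1‖ ≤ kernelBound σ b T n z.1 := fun n => by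
    filter_upwards [Measure.quasiMeasurePreserving_fst.ae (ae_gammaFamily_pos (σ := σ) (θ := θ)),
      Measure.quasiMeasurePreserving_snd.ae hvT] with z h1 h2 using norm_kernelTerm_le hσ b n h2 h1
  have hint n : Integrable (fun z : ℝ × β => kernelTerm σ b n (v z.2) z.1)
      ((gammaFamily σ θ).prod ν) :=
    (hB n).mono' ((measurable_kernelTerm σ b n).comp
      (measurable_fst.prodMk (hv.comp measurable_snd))).aestronglyMeasurable (hle n)
  refine integrable_tsum_of_summable_integral_norm hint ?_
  refine ((summable_integral_kernelBound (θ := θ) hσ hθ b T).mul_left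
    (ν.real Set.univ)).of_nonneg_of_le (fun n => integral_nonneg fun x => norm_nonneg _) fun n => ?_
  refine (integral_mono_ae (hint n).norm (hB n) (hle n)).trans_eq ?_
  rw [integral_fun_fst, smul_eq_mul]

end KernelTerm

section CosIntegral

lemma integral_exp_I_mul_eq_integral_cos (y c : ℝ) :
    ∫ s in (-1:ℝ)..(1:ℝ), Complex.exp (Complex.I * (y : ℂ) * (s : ℂ) * (c : ℂ))
      = ((∫ s in (-1:ℝ)..(1:ℝ), cos (y * s * c) : ℝ) : ℂ) := by
  have hodd : ∫ s in (-1:ℝ)..(1:ℝ), sin (y * s * c) = 0 := by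
    have h := intervalIntegral.integral_comp_neg (a := -1) (b := 1) fun s => sin (y * s * c)
    simp only [mul_neg, neg_mul, sin_neg, intervalIntegral.integral_neg, neg_neg] at h
    linarith
  have heq : ∀ s : ℝ, Complex.exp (Complex.I * (y : ℂ) * (s : ℂ) * (c : ℂ))
      = ((cos (y * s * c) : ℝ) : ℂ) + ((sin (y * s * c) : ℝ) : ℂ) * Complex.I := fun s => by
    rw [show Complex.I * (y : ℂ) * (s : ℂ) * (c : ℂ) = ((y * s * c : ℝ) : ℂ) * Complex.I by
      push_cast; ring, Complex.exp_mul_I, Complex.ofReal_cos, Complex.ofReal_sin]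
  simp_rw [heq]
  rw [intervalIntegral.integral_add (Continuous.intervalIntegrable (by fun_prop) _ _)
      (Continuous.intervalIntegrable (by fun_prop) _ _), intervalIntegral.integral_mul_const,
    intervalIntegral.integral_ofReal, intervalIntegral.integral_ofReal, hodd]
  simp

lemma mul_integral_cos_mul (y c : ℝ) :
    c * ∫ s in (-1:ℝ)..(1:ℝ), cos (y * s * c) = 2 * if y = 0 then c else sin (c * y) / y := by
  split_ifs with hy
  · simp [hy]
    ring
  · by_cases hc : c = 0
    · simp [hc]
    · have hyc : y * c ≠ 0 := mul_ne_zero hy hc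
      simp_rw [mul_right_comm y _ c]
      rw [intervalIntegral.integral_comp_mul_left (fun u => cos u) hyc, integral_cos]
      simp only [mul_neg, mul_one, sin_neg, smul_eq_mul, mul_comm c y]
      field_simp
      ring

end CosIntegral

lemma integral_kernel_gammaFamily {σ θ : ℝ} (hσ : 0 < σ) (hθ : θ < 1) (b t : ℝ) :
    ∫ x, ((1 / (2 * π)) * ∫ y in (0:ℝ)..(1:ℝ), t * ∫ s in (-1:ℝ)..(1:ℝ),
        ∑' n : ℕ, kernelTerm σ b n (t * y * s) x) ∂gammaFamily σ θ
      = (1 / (2 * π)) * ∫ y in (0:ℝ)..t, (σ / (1 - θ) - b) *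
          ∫ s in (-1:ℝ)..(1:ℝ), cos (y * s * (σ / (1 - θ) - b)) := by
  set c := σ / (1 - θ) - b with hc
  set ν₁ : Measure ℝ := volume.restrict (Set.Ioc 0 1) with hν₁
  set ν₂ : Measure ℝ := volume.restrict (Set.Ioc (-1) 1) with hν₂
  have hint : Integrable (fun z : ℝ × (ℝ × ℝ) =>
      ∑' n, kernelTerm σ b n (t * z.2.1 * z.2.2) z.1) ((gammaFamily σ θ).prod (ν₁.prod ν₂)) := by
    refine integrable_tsum_kernelTerm_prod (T := |t|) (v := fun q : ℝ × ℝ => t * q.1 * q.2)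
      hσ hθ b (by fun_prop) ?_
    rw [hν₁, hν₂, Measure.prod_restrict]
    filter_upwards [ae_restrict_mem (measurableSet_Ioc.prod measurableSet_Ioc)] with q hq
    obtain ⟨⟨h1, h2⟩, h3, h4⟩ := hq
    have hq1 : |q.1| ≤ 1 := abs_le.2 ⟨by linarith, h2⟩
    have hq2 : |q.2| ≤ 1 := abs_le.2 ⟨h3.le, h4⟩
    rw [abs_mul, abs_mul, mul_assoc]
    exact mul_le_of_le_one_right (abs_nonneg t) (mul_le_one₀ hq1 (abs_nonneg _) hq2)
  have hx : ∀ᵐ x ∂gammaFamily σ θ,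
      (1 / (2 * π)) * ∫ y in (0:ℝ)..(1:ℝ), t * ∫ s in (-1:ℝ)..(1:ℝ),
        ∑' n : ℕ, kernelTerm σ b n (t * y * s) x
      = (1 / (2 * π) * t) * ∫ q, ∑' n, kernelTerm σ b n (t * q.1 * q.2) x ∂ν₁.prod ν₂ := by
    filter_upwards [hint.prod_right_ae] with x hx
    rw [integral_prod _ hx, intervalIntegral.integral_const_mul, mul_assoc,
      intervalIntegral.integral_of_le zero_le_one]
    simp_rw [intervalIntegral.integral_of_le (show (-1 : ℝ) ≤ 1 by norm_num)]
    rfl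
  have hcos : Integrable (fun q : ℝ × ℝ => c * cos (t * q.1 * q.2 * c)) (ν₁.prod ν₂) :=
    (integrable_const |c|).mono' (by fun_prop) <| .of_forall fun q => by
      rw [norm_mul]
      exact mul_le_of_le_one_right (abs_nonneg c) (abs_cos_le_one _)
  rw [integral_congr_ae hx, integral_const_mul, integral_integral_swap hint]
  simp_rw [integral_tsum_kernelTerm hσ hθ, ← hc]
  rw [integral_prod _ hcos, mul_assoc]
  congr 1
  rw [hν₁, ← intervalIntegral.integral_of_le zero_le_one]
  simp_rw [integral_const_mul, hν₂,
    ← intervalIntegral.integral_of_le (show (-1 : ℝ) ≤ 1 by norm_num)]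
  rw [intervalIntegral.mul_integral_comp_mul_left
    (f := fun u => c * ∫ s in (-1:ℝ)..(1:ℝ), cos (u * s * c))]
  simp

/-- For the Gamma family `G_θ` (shape `σ > 0`, natural parameter `θ < 1`,
mean `μ(θ) = σ/(1−θ)`), the kernel
`K₁(t,x) = (1/(2π)) ∫₀¹ t ∫_{−1}^{1} Σₙ cos(nπ/2 − tysb)((tys)ⁿ(σx)ⁿ/n!)Γ(σ)(σx/Γ(σ+n+1) − b/Γ(σ+n)) ds dy`
satisfies `∫ K₁(t,x) dG_θ(x)
= (1/(2π)) ∫₀ᵗ (σ/(1−θ)−b)(∫_{−1}^{1} exp(iys(σ/(1−θ)−b)) ds) dy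
= (1/π) ∫₀ᵗ sin{(μ(θ)−b)y}/y dy`, the last integrand extended by `μ(θ)−b` at `y = 0`. -/
theorem matching_kernel_onesided_null_gamma
    (σ θ : ℝ) (hσ : 0 < σ) (hθ : θ < 1)
    (G : Measure ℝ)
    (hG : G = volume.withDensity (fun x : ℝ => ENNReal.ofReal
      (if 0 < x then (1 - θ)^σ * Real.exp (θ * x) * x^(σ - 1) * Real.exp (-x) / Real.Gamma σ
       else 0)))
    (b t : ℝ)
    (K₁ : ℝ → ℝ → ℝ)
    (hK₁ : ∀ t x, K₁ t x
      = (1 / (2 * π)) * ∫ y in (0:ℝ)..(1:ℝ), t * ∫ s in (-1:ℝ)..(1:ℝ),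
          ∑' n : ℕ, Real.cos ((n : ℝ) * π / 2 - t * y * s * b)
            * ((t * y * s)^n * (σ * x)^n / (n.factorial : ℝ))
            * Real.Gamma σ * (σ * x / Real.Gamma (σ + (n : ℝ) + 1) - b / Real.Gamma (σ + (n : ℝ)))) :
    ((∫ x, K₁ t x ∂G : ℝ) : ℂ)
        = (1 / (2 * (π : ℂ))) * ∫ y in (0:ℝ)..t,
            ((σ / (1 - θ) - b : ℝ) : ℂ) * ∫ s in (-1:ℝ)..(1:ℝ),
              Complex.exp (Complex.I * (y : ℂ) * (s : ℂ) * ((σ / (1 - θ) - b : ℝ) : ℂ))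
      ∧ (∫ x, K₁ t x ∂G)
        = (1/π) * ∫ y in (0:ℝ)..t,
            if y = 0 then (σ / (1 - θ) - b) else Real.sin ((σ / (1 - θ) - b) * y) / y := by
  subst hG
  change (((∫ x, K₁ t x ∂gammaFamily σ θ : ℝ) : ℂ) = _) ∧ (∫ x, K₁ t x ∂gammaFamily σ θ) = _
  have hK : ∫ x, K₁ t x ∂gammaFamily σ θ
      = (1 / (2 * π)) * ∫ y in (0:ℝ)..t, (σ / (1 - θ) - b) *
          ∫ s in (-1:ℝ)..(1:ℝ), cos (y * s * (σ / (1 - θ) - b)) := by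
    rw [← integral_kernel_gammaFamily hσ hθ]
    exact integral_congr_ae (.of_forall fun x => hK₁ t x)
  rw [hK]
  constructor
  · simp_rw [integral_exp_I_mul_eq_integral_cos, ← Complex.ofReal_mul]
    rw [intervalIntegral.integral_ofReal]
    push_cast
    rfl
  · simp_rw [mul_integral_cos_mul]
    rw [intervalIntegral.integral_const_mul, ← mul_assoc]
    congr 1
    field_simp
end

section
/- Let a < b be reals and let φ : [a,b] → ℝ be continuous and of bounded variation. Define K₁(t,x) = (t/(2π)) ∫_a^b φ(y) ( ∫_{[−1,1]} exp{i t s (x−y)}/r₀(t s) ds ) dy. Then for every μ ∈ ℝ and every t ∈ ℝ, ∫ K₁(t,x) dF_μ(x) = D_φ(t,μ;a,b), where D_φ(t,μ;a,b) = (1/π) ∫_a^b [sin{(μ−y)t}/(μ−y)] φ(y) dy with the kernel y ↦ sin{(μ−y)t}/(μ−y) extended by the value t at y = μ. -/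
open MeasureTheory Real

/-- Fubini for a continuous integrand that is bounded on the strip `ℝ × [a, b]`. -/
lemma integral_intervalIntegral_swap_of_bounded (ν : Measure ℝ) [IsFiniteMeasure ν]
    {a b C : ℝ} (hab : a ≤ b) {f : ℝ → ℝ → ℂ} (hf : Continuous (Function.uncurry f))
    (hC : ∀ x, ∀ y ∈ Set.Icc a b, ‖f x y‖ ≤ C) :
    ∫ x, (∫ y in a..b, f x y) ∂ν = ∫ y in a..b, (∫ x, f x y ∂ν) := by
  simp_rw [intervalIntegral.integral_of_le hab]
  refine integral_integral_swap ?_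
  refine Integrable.of_bound hf.aestronglyMeasurable C ?_
  have h : ∀ᵐ p ∂(ν.prod (volume.restrict (Set.Ioc a b))), p.2 ∈ Set.Ioc a b :=
    Measure.quasiMeasurePreserving_snd.ae (ae_restrict_mem measurableSet_Ioc)
  filter_upwards [h] with p hp using hC p.1 p.2 (Set.Ioc_subset_Icc_self hp)

/-- The Dirichlet kernel as a scaled Fourier integral over `[-1, 1]`. -/
lemma div_two_pi_mul_intervalIntegral_exp (t z : ℝ) :
    ((t : ℂ) / (2 * (π : ℂ))) *
        ∫ s in (-1:ℝ)..(1:ℝ), Complex.exp (Complex.I * (t : ℂ) * (s : ℂ) * (z : ℂ))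
      = (((1/π) * (if z = 0 then t else Real.sin (z * t) / z) : ℝ) : ℂ) := by
  have hπ : (π : ℂ) ≠ 0 := by exact_mod_cast Real.pi_ne_zero
  by_cases hz : z = 0
  · subst hz
    simp
    norm_num
    field_simp
  by_cases ht : t = 0
  · subst ht
    simp
  have hz' : (z : ℂ) ≠ 0 := by exact_mod_cast hz
  have ht' : (t : ℂ) ≠ 0 := by exact_mod_cast ht
  have hc : Complex.I * (t : ℂ) * (z : ℂ) ≠ 0 :=
    mul_ne_zero (mul_ne_zero Complex.I_ne_zero ht') hz'
  have h : ∀ s : ℝ, Complex.I * (t : ℂ) * (s : ℂ) * (z : ℂ)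
      = Complex.I * (t : ℂ) * (z : ℂ) * (s : ℂ) := fun s => by ring
  simp_rw [h]
  rw [integral_exp_mul_complex hc, if_neg hz]
  push_cast
  rw [Complex.sin]
  have h1 : Complex.I * (t : ℂ) * (z : ℂ) * 1 = (z : ℂ) * t * Complex.I := by ring
  have h2 : Complex.I * (t : ℂ) * (z : ℂ) * (-1) = -((z : ℂ) * t) * Complex.I := by ring
  rw [h1, h2]
  field_simp
  linear_combination (Complex.exp ((t : ℂ) * z * Complex.I) -
    Complex.exp (-((t : ℂ) * z * Complex.I))) * Complex.I_sq


/-- For a Type I location-shift family `{F_μ}` generated by a probability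
measure `ν` with real, strictly positive characteristic function `r₀`, reals `a < b`, and
`φ : [a,b] → ℝ` continuous and of bounded variation, the kernel
`K₁(t,x) = (t/(2π)) ∫_a^b φ(y) (∫_{[−1,1]} exp{its(x−y)}/r₀(ts) ds) dy` satisfies
`∫ K₁(t,x) dF_μ(x) = D_φ(t,μ;a,b)` for all `μ, t`, where
`D_φ(t,μ;a,b) = (1/π) ∫_a^b [sin{(μ−y)t}/(μ−y)] φ(y) dy` with the kernel extended by `t`
at `y = μ`. -/
theorem matching_kernel_functional_bounded_null_locationShift
    (ν : Measure ℝ) [IsProbabilityMeasure ν]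
    (r₀ : ℝ → ℝ)
    (hr₀_pos : ∀ t : ℝ, 0 < r₀ t)
    (hr₀_cf : ∀ t : ℝ, (∫ x, Complex.exp (Complex.I * (t : ℂ) * (x : ℂ)) ∂ν) = ((r₀ t : ℝ) : ℂ))
    (F : ℝ → Measure ℝ)
    (hF : ∀ μ : ℝ, F μ = Measure.map (fun x => x + μ) ν)
    (a b : ℝ) (hab : a < b)
    (φ : ℝ → ℝ)
    (hφ_cont : ContinuousOn φ (Set.Icc a b))
    (hφ_BV : BoundedVariationOn φ (Set.Icc a b))
    (K₁ : ℝ → ℝ → ℂ)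
    (hK₁ : ∀ t x, K₁ t x
      = ((t : ℂ) / (2 * (π : ℂ))) * ∫ y in a..b,
          (φ y : ℂ) * ∫ s in (-1:ℝ)..(1:ℝ),
            Complex.exp (Complex.I * (t : ℂ) * (s : ℂ) * ((x : ℂ) - (y : ℂ)))
              / ((r₀ (t * s) : ℝ) : ℂ)) :
    ∀ μ t : ℝ,
      (∫ x, K₁ t x ∂(F μ))
        = (((1/π) * ∫ y in a..b,
            (if y = μ then t else Real.sin ((μ - y) * t) / (μ - y)) * φ y : ℝ) : ℂ) := by
  intro μ t
  have hr₀_eq : ∀ u : ℝ, charFun ν u = (r₀ u : ℂ) := fun u => by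
    rw [charFun_apply_real, ← hr₀_cf u]
    congr 1 with x
    ring_nf
  have hr₀_cont : Continuous fun u : ℝ => (r₀ u : ℂ) := by
    simpa only [← hr₀_eq] using (continuous_charFun (μ := ν))
  have hr₀_ne : ∀ u, (r₀ u : ℂ) ≠ 0 := fun u => by exact_mod_cast (hr₀_pos u).ne'
  set ψ : ℝ → ℝ := Set.IccExtend hab.le (Set.domRestrict (Set.Icc a b) φ) with hψ
  have hψ_cont : Continuous ψ := hφ_cont.domRestrict.Icc_extend'
  have hψ_eq : ∀ y ∈ Set.uIcc a b, φ y = ψ y := fun y hy => by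
    rw [Set.uIcc_of_le hab.le] at hy
    rw [hψ, Set.IccExtend_of_mem hab.le _ hy, Set.domRestrict_apply]
  set e : ℝ → ℝ → ℝ → ℂ := fun x y s =>
    Complex.exp (Complex.I * (t : ℂ) * (s : ℂ) * ((x : ℂ) - (y : ℂ))) / ((r₀ (t * s) : ℝ) : ℂ)
    with he
  set G : ℝ → ℝ → ℂ := fun x y => ∫ s in (-1:ℝ)..(1:ℝ), e x y s with hG
  have he_cont : Continuous fun p : (ℝ × ℝ) × ℝ => e p.1.1 p.1.2 p.2 := by
    refine Continuous.div (by fun_prop) ?_ fun _ => hr₀_ne _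
    exact hr₀_cont.comp (continuous_const.mul continuous_snd)
  have hG_cont : Continuous fun p : ℝ × ℝ => G p.1 p.2 :=
    intervalIntegral.continuous_parametric_intervalIntegral_of_continuous' he_cont _ _
  have he_norm : ∀ x y s, ‖e x y s‖ = ‖((r₀ (t * s) : ℝ) : ℂ)⁻¹‖ := fun x y s => by
    have h : Complex.I * (t : ℂ) * (s : ℂ) * ((x : ℂ) - (y : ℂ))
        = ((t * s * (x - y) : ℝ) : ℂ) * Complex.I := by push_cast; ring
    simp only [he, norm_div, norm_inv, h, Complex.norm_exp_ofReal_mul_I, one_div]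
  obtain ⟨C, hC⟩ := (isCompact_Icc (a := (-1:ℝ)) (b := 1)).exists_bound_of_continuousOn
    (f := fun s : ℝ => ((r₀ (t * s) : ℝ) : ℂ)⁻¹)
    ((hr₀_cont.comp (continuous_const.mul continuous_id)).inv₀ fun _ => hr₀_ne _).continuousOn
  have he_bound : ∀ x y, ∀ s ∈ Set.Icc (-1:ℝ) 1, ‖e x y s‖ ≤ C := fun x y s hs =>
    (he_norm x y s).trans_le (hC s hs)
  have hG_bound : ∀ x y, ‖G x y‖ ≤ C * |1 - (-1:ℝ)| := fun x y =>
    intervalIntegral.norm_integral_le_of_norm_le_const fun s hs =>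
      he_bound x y s (Set.uIoc_subset_uIcc.trans_eq (Set.uIcc_of_le (by norm_num)) hs)
  obtain ⟨M, hM⟩ := (isCompact_Icc (a := a) (b := b)).exists_bound_of_continuousOn
    hψ_cont.continuousOn
  have hM_nonneg : 0 ≤ M := (norm_nonneg _).trans (hM a (Set.left_mem_Icc.2 hab.le))
  have hK : ∀ x, K₁ t x = ((t : ℂ) / (2 * (π : ℂ))) * ∫ y in a..b, (ψ y : ℂ) * G x y := fun x => by
    rw [hK₁]
    congr 1
    exact intervalIntegral.integral_congr fun y hy => by simp only [hψ_eq y hy, hG, he]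
  have hshift : ∫ x, K₁ t x ∂(F μ) = ∫ x, K₁ t (x + μ) ∂ν := by
    rw [hF]
    exact (measurableEmbedding_addRight μ).integral_map _
  have hinner : ∀ y, ∫ x, G (x + μ) y ∂ν
      = ∫ s in (-1:ℝ)..(1:ℝ),
          Complex.exp (Complex.I * (t : ℂ) * (s : ℂ) * ((μ - y : ℝ) : ℂ)) := fun y => by
    rw [hG, integral_intervalIntegral_swap_of_bounded ν (by norm_num : (-1:ℝ) ≤ 1)
      (f := fun x s => e (x + μ) y s)
      (he_cont.comp (f := fun p : ℝ × ℝ => ((p.1 + μ, y), p.2)) (by fun_prop))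
      fun x s hs => he_bound _ _ s hs]
    refine intervalIntegral.integral_congr fun s _ => ?_
    have h : ∀ x : ℝ, e (x + μ) y s
        = Complex.exp (Complex.I * ((t * s : ℝ) : ℂ) * (x : ℂ)) *
          (Complex.exp (Complex.I * (t : ℂ) * (s : ℂ) * ((μ - y : ℝ) : ℂ))
            / ((r₀ (t * s) : ℝ) : ℂ)) := fun x => by
      rw [← mul_div_assoc, ← Complex.exp_add, he]
      push_cast
      ring_nf
    simp_rw [h]
    rw [integral_mul_const, hr₀_cf, mul_div_cancel₀ _ (hr₀_ne _)]
  rw [hshift]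
  simp_rw [hK]
  rw [integral_const_mul, integral_intervalIntegral_swap_of_bounded ν hab.le
    (C := M * (C * |1 - (-1:ℝ)|)) (f := fun x y => (ψ y : ℂ) * G (x + μ) y)]
  · simp_rw [integral_const_mul, hinner]
    rw [← intervalIntegral.integral_const_mul, ← intervalIntegral.integral_const_mul,
      ← intervalIntegral.integral_ofReal]
    refine intervalIntegral.integral_congr fun y hy => ?_
    have h := div_two_pi_mul_intervalIntegral_exp t (μ - y)
    have hy0 : (μ - y = 0) ↔ (y = μ) := by rw [sub_eq_zero, eq_comm]
    simp only [hy0] at h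
    rw [mul_left_comm, h, hψ_eq y hy, ← Complex.ofReal_mul]
    congr 1
    ring
  · exact (Complex.continuous_ofReal.comp (hψ_cont.comp continuous_snd)).mul
      (hG_cont.comp (f := fun p : ℝ × ℝ => (p.1 + μ, p.2)) (by fun_prop))
  · intro x y hy
    rw [norm_mul, Complex.norm_real]
    exact mul_le_mul (hM y hy) (hG_bound _ _) (norm_nonneg _) hM_nonneg
end
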